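/- arXiv:2101.06417 — 6 statements merged into one kernel-verified Lean document; each statement's English description precedes it below -/
import Mathlib

section
/- Suppose each γ ↦ h(γ, z_i) (i = 1,…,n) is ĉ-strongly convex for some ĉ > 0 and ∇²f(γ) ⪰ 0 for all γ. Let γ̂ : [−1, 0] → ℝ^K be a differentiable curve satisfying ∇_γ F(γ̂(τ)) + τ·∇_γ h(γ̂(τ), z_j) = 0 for every τ ∈ [−1, 0], and suppose ‖∇_γ h(γ̂(τ), z_j)‖ ≤ M for all τ ∈ [−1, 0]. Then for every τ ∈ [−1, 0] the matrix ∇²_γ F(γ̂(τ)) + τ·∇²_γ h(γ̂(τ), z_j) is invertible, the derivative of the curve satisfies γ̂′(τ) = −(∇²_γ F(γ̂(τ)) + τ·∇²_γ h(γ̂(τ), z_j))^{−1} · ∇_γ h(γ̂(τ), z_j), and ‖γ̂′(τ)‖ ≤ M/((n−1)·ĉ). -/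
open Set
open scoped RealInnerProductSpace

noncomputable section

/-- The Hessian of `g` at `γ`, as the (continuous linear) derivative of the gradient field. -/
def hessCLM {K : ℕ} (g : EuclideanSpace ℝ (Fin K) → ℝ) (γ : EuclideanSpace ℝ (Fin K)) :
    EuclideanSpace ℝ (Fin K) →L[ℝ] EuclideanSpace ℝ (Fin K) :=
  fderiv ℝ (gradient g) γ

/-- `g` is `c`-strongly convex: `∇²g(γ) ⪰ c·I` for every `γ`. -/
def StrongConvexHess {K : ℕ} (c : ℝ) (g : EuclideanSpace ℝ (Fin K) → ℝ) : Prop :=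
  ∀ γ v, c * ‖v‖ ^ 2 ≤ ⟪hessCLM g γ v, v⟫

theorem grad_differentiable {K : ℕ} {g : EuclideanSpace ℝ (Fin K) → ℝ} (hg : ContDiff ℝ 3 g) :
    Differentiable ℝ (gradient g) := by
  have h1 : ContDiff ℝ 2 (fderiv ℝ g) := hg.fderiv_right (by norm_num)
  have h2 : Differentiable ℝ (fderiv ℝ g) := h1.differentiable (by norm_num)
  intro x
  exact ((InnerProductSpace.toDual ℝ (EuclideanSpace ℝ (Fin K))).symm.toContinuousLinearEquiv.toContinuousLinearMap.differentiableAt).comp x (h2 x)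

theorem grad_sum {K n : ℕ} {g : Fin n → EuclideanSpace ℝ (Fin K) → ℝ}
    {f : EuclideanSpace ℝ (Fin K) → ℝ} (hg : ∀ i, ContDiff ℝ 3 (g i)) (hf : ContDiff ℝ 3 f) :
    gradient (fun γ => (∑ i, g i γ) + f γ) = fun γ => (∑ i, gradient (g i) γ) + gradient f γ := by
  funext x
  have hgd : ∀ i, DifferentiableAt ℝ (g i) x := fun i => (hg i).differentiable (by norm_num) x
  have hfd : DifferentiableAt ℝ f x := hf.differentiable (by norm_num) x
  unfold gradient
  rw [fderiv_fun_add (DifferentiableAt.fun_sum fun i _ => hgd i) hfd,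
    fderiv_fun_sum fun i _ => hgd i, map_add, map_sum]

theorem hess_sum {K n : ℕ} {g : Fin n → EuclideanSpace ℝ (Fin K) → ℝ}
    {f : EuclideanSpace ℝ (Fin K) → ℝ} (hg : ∀ i, ContDiff ℝ 3 (g i)) (hf : ContDiff ℝ 3 f)
    (x : EuclideanSpace ℝ (Fin K)) :
    hessCLM (fun γ => (∑ i, g i γ) + f γ) x = (∑ i, hessCLM (g i) x) + hessCLM f x := by
  have hgd : ∀ i, DifferentiableAt ℝ (gradient (g i)) x := fun i => grad_differentiable (hg i) x
  have hfd : DifferentiableAt ℝ (gradient f) x := grad_differentiable hf x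
  unfold hessCLM
  rw [grad_sum hg hf, fderiv_fun_add (DifferentiableAt.fun_sum fun i _ => hgd i) hfd,
    fderiv_fun_sum fun i _ => hgd i]

theorem coercive_unit {K : ℕ} {m : ℝ} (hm : 0 < m)
    (A : EuclideanSpace ℝ (Fin K) →L[ℝ] EuclideanSpace ℝ (Fin K))
    (hA : ∀ v, m * ‖v‖ ^ 2 ≤ ⟪A v, v⟫) : IsUnit A := by
  have hinj : Function.Injective A := by
    rw [injective_iff_map_eq_zero]
    intro v hv
    have := hA v
    rw [hv, inner_zero_left] at this
    have h2 : ‖v‖ ^ 2 ≤ 0 := by nlinarith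
    have : ‖v‖ = 0 := by nlinarith [norm_nonneg v]
    exact norm_eq_zero.mp this
  have hsurj : Function.Surjective A :=
    (LinearMap.injective_iff_surjective (f := A.toLinearMap)).mp hinj
  exact ContinuousLinearMap.isUnit_iff_bijective.mpr ⟨hinj, hsurj⟩

theorem coercive_norm {K : ℕ} {m : ℝ} (hm : 0 < m)
    (A : EuclideanSpace ℝ (Fin K) →L[ℝ] EuclideanSpace ℝ (Fin K))
    (hA : ∀ v, m * ‖v‖ ^ 2 ≤ ⟪A v, v⟫) (v : EuclideanSpace ℝ (Fin K)) : m * ‖v‖ ≤ ‖A v‖ := by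
  rcases eq_or_lt_of_le (norm_nonneg v) with h0 | h0
  · rw [← h0, mul_zero]; exact norm_nonneg _
  · have h1 := (hA v).trans (real_inner_le_norm (A v) v)
    have : (m * ‖v‖) * ‖v‖ ≤ ‖A v‖ * ‖v‖ := by nlinarith
    exact le_of_mul_le_mul_right this h0

/-- If each `γ ↦ h(γ, zᵢ)` is `ĉ`-strongly convex, `∇²f ⪰ 0`, and
`γ̂ : [−1,0] → ℝ^K` is a differentiable curve with `∇F(γ̂(τ)) + τ∇h(γ̂(τ), z_j) = 0` and
`‖∇h(γ̂(τ), z_j)‖ ≤ M` on `[−1,0]`, then for every `τ ∈ [−1,0]` the Hessian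
`∇²F(γ̂(τ)) + τ∇²h(γ̂(τ), z_j)` is invertible,
`γ̂′(τ) = −(∇²F(γ̂(τ)) + τ∇²h(γ̂(τ), z_j))⁻¹ ∇h(γ̂(τ), z_j)`, and
`‖γ̂′(τ)‖ ≤ M/((n−1)ĉ)`. -/
theorem stmt_3 {K : ℕ} (hK : 1 ≤ K) {Z : Type*} {n : ℕ} (hn : 2 ≤ n)
    (z : Fin n → Z) (j : Fin n)
    (h : EuclideanSpace ℝ (Fin K) → Z → ℝ) (f : EuclideanSpace ℝ (Fin K) → ℝ)
    (hf3 : ContDiff ℝ 3 f)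
    (hh3 : ∀ i, ContDiff ℝ 3 (fun γ => h γ (z i)))
    (c : ℝ) (hc : 0 < c)
    (hhconv : ∀ i, StrongConvexHess c (fun γ => h γ (z i)))
    (hfpsd : StrongConvexHess 0 f)
    (γhat γhat' : ℝ → EuclideanSpace ℝ (Fin K))
    (hderiv : ∀ τ ∈ Icc (-1 : ℝ) 0, HasDerivAt γhat (γhat' τ) τ)
    (hgrad : ∀ τ ∈ Icc (-1 : ℝ) 0,
      gradient (fun γ => (∑ i, h γ (z i)) + f γ) (γhat τ)
          + τ • gradient (fun γ => h γ (z j)) (γhat τ) = 0)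
    (M : ℝ)
    (hMbd : ∀ τ ∈ Icc (-1 : ℝ) 0, ‖gradient (fun γ => h γ (z j)) (γhat τ)‖ ≤ M) :
    ∀ τ ∈ Icc (-1 : ℝ) 0,
      IsUnit (hessCLM (fun γ => (∑ i, h γ (z i)) + f γ) (γhat τ)
          + τ • hessCLM (fun γ => h γ (z j)) (γhat τ)) ∧
      γhat' τ = -(Ring.inverse (hessCLM (fun γ => (∑ i, h γ (z i)) + f γ) (γhat τ)
          + τ • hessCLM (fun γ => h γ (z j)) (γhat τ)))
            (gradient (fun γ => h γ (z j)) (γhat τ)) ∧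
      ‖γhat' τ‖ ≤ M / (((n : ℝ) - 1) * c) := by
  intro τ hτ
  have hn' : (2 : ℝ) ≤ n := by exact_mod_cast hn
  have hm : 0 < ((n : ℝ) - 1) * c := mul_pos (by linarith) hc
  set F : EuclideanSpace ℝ (Fin K) → ℝ := fun γ => (∑ i, h γ (z i)) + f γ with hF
  set A := hessCLM F (γhat τ) + τ • hessCLM (fun γ => h γ (z j)) (γhat τ) with hAdef
  have hFc : ContDiff ℝ 3 F := (ContDiff.sum fun i _ => hh3 i).add hf3
  have hA : ∀ v, (((n : ℝ) - 1) * c) * ‖v‖ ^ 2 ≤ ⟪A v, v⟫ := by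
    intro v
    have e : hessCLM F (γhat τ) = _ := hess_sum (g := fun i γ => h γ (z i)) hh3 hf3 (γhat τ)
    have hfv := hfpsd (γhat τ) v
    have hjv := hhconv j (γhat τ) v
    have hsum : ∑ i ∈ Finset.univ.erase j, c * ‖v‖ ^ 2 ≤
        ∑ i ∈ Finset.univ.erase j, ⟪hessCLM (fun γ => h γ (z i)) (γhat τ) v, v⟫ :=
      Finset.sum_le_sum fun i _ => hhconv i (γhat τ) v
    rw [Finset.sum_const, Finset.card_erase_of_mem (Finset.mem_univ j), Finset.card_univ,
      Fintype.card_fin, nsmul_eq_mul, Nat.cast_sub (by omega), Nat.cast_one] at hsum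
    have hsplit := Finset.add_sum_erase Finset.univ
      (fun i => ⟪hessCLM (fun γ => h γ (z i)) (γhat τ) v, v⟫) (Finset.mem_univ j)
    have hAv : ⟪A v, v⟫ = (∑ i, ⟪hessCLM (fun γ => h γ (z i)) (γhat τ) v, v⟫)
        + ⟪hessCLM f (γhat τ) v, v⟫ + τ * ⟪hessCLM (fun γ => h γ (z j)) (γhat τ) v, v⟫ := by
      rw [hAdef, e]
      simp [inner_add_left, sum_inner, inner_smul_left]
    have hp : 0 ≤ c * ‖v‖ ^ 2 := by positivity
    have h1 : 0 ≤ (1 + τ) * ⟪hessCLM (fun γ => h γ (z j)) (γhat τ) v, v⟫ :=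
      mul_nonneg (by linarith [hτ.1]) (hp.trans hjv)
    rw [hAv, ← hsplit]
    nlinarith
  have hU : IsUnit A := coercive_unit hm A hA
  have hkey : A (γhat' τ) = - gradient (fun γ => h γ (z j)) (γhat τ) := by
    have d1 := ((grad_differentiable hFc (γhat τ)).hasFDerivAt).comp_hasDerivAt τ (hderiv τ hτ)
    have d2 := ((grad_differentiable (hh3 j) (γhat τ)).hasFDerivAt).comp_hasDerivAt τ (hderiv τ hτ)
    have d3 := (d1.add ((hasDerivAt_id τ).smul d2)).hasDerivWithinAt (s := Icc (-1 : ℝ) 0)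
    have d4 : HasDerivWithinAt (fun _ : ℝ => (0 : EuclideanSpace ℝ (Fin K))) 0 (Icc (-1 : ℝ) 0) τ :=
      hasDerivWithinAt_const _ _ _
    have d5 := d4.congr (f₁ := fun t => gradient F (γhat t) + t • gradient (fun γ => h γ (z j)) (γhat t))
      (fun t ht => hgrad t ht) (hgrad τ hτ)
    have := (uniqueDiffOn_Icc (by norm_num : (-1 : ℝ) < 0) τ hτ).eq_deriv _ d3 d5
    rw [eq_neg_iff_add_eq_zero, ← this, hAdef]
    simp [hessCLM, add_assoc]
  refine ⟨hU, ?_, ?_⟩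
  · have : (Ring.inverse A * A) (γhat' τ) = γhat' τ := by
      rw [Ring.inverse_mul_cancel _ hU]; rfl
    rw [mul_apply_eq_comp, hkey, map_neg] at this
    exact this.symm
  · rw [le_div_iff₀ hm, mul_comm]
    refine (coercive_norm hm A hA _).trans ?_
    rw [hkey, norm_neg]
    exact hMbd τ hτ
end
end

section
/- Fix K ≥ 1 and constants ĉ > 0, M ≥ 0, L ≥ 0, M₃ ≥ 0. There exists a constant C, depending only on K, ĉ, M, L and M₃, with the following property. For every n ≥ 2, data z_1,…,z_n, index j, suppose (i) each γ ↦ h(γ, z_i) is ĉ-strongly convex and ∇²f(γ) ⪰ 0 for all γ, and there is a twice continuously differentiable curve γ̂ : [−1, 0] → ℝ^K such that for each τ ∈ [−1, 0], γ̂(τ) is the global minimizer of F_τ(γ) = F(γ) + τ·h(γ, z_j); suppose further (ii) ‖∇_γ h(γ̂(τ), z_j)‖ ≤ M, ‖∇²_γ h(γ̂(τ), z_j)‖ ≤ L, and all third-order partial derivatives in γ of f and of each h(·, z_i) are bounded in absolute value by M₃ at every point γ̂(τ). Let γ_S = γ̂(0) be the global minimizer of F and γ_{S∖{z_j}} = γ̂(−1)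 be the global minimizer of γ ↦ F(γ) − h(γ, z_j). Then ‖γ_{S∖{z_j}} − γ_S − (∇²_γ F(γ_S))^{−1} · ∇_γ h(γ_S, z_j)‖ ≤ C/n². -/
open Set
open scoped RealInnerProductSpace

noncomputable section

/-! helper lemmas -/

lemma aux_grad_hasFDerivAt {K : ℕ} {g : EuclideanSpace ℝ (Fin K) → ℝ} (hg : ContDiff ℝ 3 g)
    (x : EuclideanSpace ℝ (Fin K)) : HasFDerivAt (gradient g) (hessCLM g x) x := by
  have h1 : ContDiff ℝ 2 (fderiv ℝ g) := hg.fderiv_right (by norm_num)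
  have h2 : ContDiff ℝ 2 (gradient g) :=
    (InnerProductSpace.toDual ℝ (EuclideanSpace ℝ (Fin K))).symm.toContinuousLinearEquiv.contDiff.comp h1
  exact ((h2.differentiable (by norm_num)) x).hasFDerivAt

lemma aux_hess_hasFDerivAt {K : ℕ} {g : EuclideanSpace ℝ (Fin K) → ℝ} (hg : ContDiff ℝ 3 g)
    (x : EuclideanSpace ℝ (Fin K)) : HasFDerivAt (hessCLM g) (fderiv ℝ (hessCLM g) x) x := by
  have h1 : ContDiff ℝ 2 (fderiv ℝ g) := hg.fderiv_right (by norm_num)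
  have h2 : ContDiff ℝ 2 (gradient g) :=
    (InnerProductSpace.toDual ℝ (EuclideanSpace ℝ (Fin K))).symm.toContinuousLinearEquiv.contDiff.comp h1
  have h3 : ContDiff ℝ 1 (hessCLM g) := h2.fderiv_right (by norm_num)
  exact ((h3.differentiable (by norm_num)) x).hasFDerivAt

lemma aux_hess_inner {K : ℕ} {g : EuclideanSpace ℝ (Fin K) → ℝ} (hg : ContDiff ℝ 3 g)
    (x v w : EuclideanSpace ℝ (Fin K)) :
    ⟪hessCLM g x v, w⟫ = fderiv ℝ (fderiv ℝ g) x v w := by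
  have h1 : ContDiff ℝ 2 (fderiv ℝ g) := hg.fderiv_right (by norm_num)
  have h2 : HasFDerivAt (fun y => ⟪gradient g y, w⟫)
      ((innerSL ℝ w).comp (hessCLM g x)) x := by
    have := (innerSL ℝ w).hasFDerivAt.comp x (aux_grad_hasFDerivAt hg x)
    refine this.congr_of_eventuallyEq (Filter.Eventually.of_forall fun y => ?_)
    simp [real_inner_comm]
  have h3 : HasFDerivAt (fun y => fderiv ℝ g y w)
      ((fderiv ℝ (fderiv ℝ g) x).flip w) x :=
    by simpa using ((h1.differentiable (by norm_num)) x).hasFDerivAt.clm_apply (hasFDerivAt_const w x)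
  have h4 : (fun y => ⟪gradient g y, w⟫) = fun y => fderiv ℝ g y w := by
    funext y; simp [gradient]
  rw [h4] at h2
  have := DFunLike.congr_fun (h2.unique h3) v
  simpa [real_inner_comm] using this

lemma aux_third_inner {K : ℕ} {g : EuclideanSpace ℝ (Fin K) → ℝ} (hg : ContDiff ℝ 3 g)
    (x u v w : EuclideanSpace ℝ (Fin K)) :
    ⟪fderiv ℝ (hessCLM g) x u v, w⟫ = iteratedFDeriv ℝ 3 g x ![u, v, w] := by
  have h1 : ContDiff ℝ 2 (fderiv ℝ g) := hg.fderiv_right (by norm_num)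
  have h1' : ContDiff ℝ 1 (fderiv ℝ (fderiv ℝ g)) := h1.fderiv_right (by norm_num)
  have hd := ((h1'.differentiable (by norm_num)) x).hasFDerivAt
  have h2 : HasFDerivAt (fun y => ⟪hessCLM g y v, w⟫)
      ((innerSL ℝ w).comp ((fderiv ℝ (hessCLM g) x).flip v)) x := by
    have h0 : HasFDerivAt (fun y => hessCLM g y v) ((fderiv ℝ (hessCLM g) x).flip v) x := by
      simpa using (aux_hess_hasFDerivAt hg x).clm_apply (hasFDerivAt_const v x)
    have := (innerSL ℝ w).hasFDerivAt.comp x h0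
    refine this.congr_of_eventuallyEq (Filter.Eventually.of_forall fun y => ?_)
    simp [real_inner_comm]
  have h3 : HasFDerivAt (fun y => fderiv ℝ (fderiv ℝ g) y v w)
      (((fderiv ℝ (fderiv ℝ (fderiv ℝ g)) x).flip v).flip w) x := by
    have h0 : HasFDerivAt (fun y => fderiv ℝ (fderiv ℝ g) y v)
      ((fderiv ℝ (fderiv ℝ (fderiv ℝ g)) x).flip v) x := by
      simpa using hd.clm_apply (hasFDerivAt_const v x)
    simpa using h0.clm_apply (hasFDerivAt_const w x)
  have h4 : (fun y => ⟪hessCLM g y v, w⟫) = fun y => fderiv ℝ (fderiv ℝ g) y v w := by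
    funext y; exact aux_hess_inner hg y v w
  rw [h4] at h2
  have := DFunLike.congr_fun (h2.unique h3) u
  have e : iteratedFDeriv ℝ 3 g x ![u, v, w] = fderiv ℝ (fderiv ℝ (fderiv ℝ g)) x u v w := by
    rw [iteratedFDeriv_succ_apply_right]
    rw [iteratedFDeriv_two_apply]
    rfl
  rw [e]
  simpa [real_inner_comm] using this

lemma aux_third_bound {K : ℕ} {g : EuclideanSpace ℝ (Fin K) → ℝ}
    (x : EuclideanSpace ℝ (Fin K)) (B : ℝ) (hB : 0 ≤ B)
    (hb : ∀ a b e : Fin K, |iteratedFDeriv ℝ 3 g x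
              ![EuclideanSpace.single a (1 : ℝ), EuclideanSpace.single b (1 : ℝ),
                EuclideanSpace.single e (1 : ℝ)]| ≤ B)
    (hg : ContDiff ℝ 3 g) : ‖fderiv ℝ (hessCLM g) x‖ ≤ (K : ℝ) ^ 3 * B := by
  have key : ∀ u v w, |⟪fderiv ℝ (hessCLM g) x u v, w⟫| ≤ (K : ℝ) ^ 3 * B * ‖u‖ * ‖v‖ * ‖w‖ := by
    intro u v w
    have dec : ∀ u : EuclideanSpace ℝ (Fin K), u = ∑ a, u a • EuclideanSpace.single a (1:ℝ) := by
      intro u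
      ext i
      simp [Pi.single_apply]
    have hn : ∀ (u : EuclideanSpace ℝ (Fin K)) a, |u a| ≤ ‖u‖ := fun u a => by
      simpa using PiLp.norm_apply_le u a
    have e : ⟪fderiv ℝ (hessCLM g) x u v, w⟫ = ∑ a, ∑ b, ∑ e, u a * v b * w e *
        iteratedFDeriv ℝ 3 g x
              ![EuclideanSpace.single a (1 : ℝ), EuclideanSpace.single b (1 : ℝ),
                EuclideanSpace.single e (1 : ℝ)] := by
      have s1 : ∀ v w, ⟪fderiv ℝ (hessCLM g) x u v, w⟫ =
          ∑ a, u a * ⟪fderiv ℝ (hessCLM g) x (EuclideanSpace.single a (1:ℝ)) v, w⟫ := by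
        intro v w
        conv_lhs => rw [dec u]
        simp only [map_sum, map_smul, sum_apply, smul_apply, sum_inner, real_inner_smul_left]
      have s2 : ∀ u w, ⟪fderiv ℝ (hessCLM g) x u v, w⟫ =
          ∑ a, v a * ⟪fderiv ℝ (hessCLM g) x u (EuclideanSpace.single a (1:ℝ)), w⟫ := by
        intro u w
        conv_lhs => rw [dec v]
        simp only [map_sum, map_smul, sum_inner, real_inner_smul_left]
      have s3 : ∀ u v, ⟪fderiv ℝ (hessCLM g) x u v, w⟫ =
          ∑ a, w a * ⟪fderiv ℝ (hessCLM g) x u v, EuclideanSpace.single a (1:ℝ)⟫ := by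
        intro u v
        conv_lhs => rw [dec w]
        simp only [inner_sum, real_inner_smul_right]
      rw [s1]
      refine Finset.sum_congr rfl fun a _ => ?_
      rw [s2, Finset.mul_sum]
      refine Finset.sum_congr rfl fun b _ => ?_
      rw [s3, Finset.mul_sum, Finset.mul_sum]
      refine Finset.sum_congr rfl fun e _ => ?_
      rw [aux_third_inner hg]
      ring
    rw [e]
    calc _ ≤ ∑ a : Fin K, ∑ b : Fin K, ∑ e : Fin K, ‖u‖ * ‖v‖ * ‖w‖ * B := by
          refine (Finset.abs_sum_le_sum_abs _ _).trans (Finset.sum_le_sum fun a _ => ?_)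
          refine (Finset.abs_sum_le_sum_abs _ _).trans (Finset.sum_le_sum fun b _ => ?_)
          refine (Finset.abs_sum_le_sum_abs _ _).trans (Finset.sum_le_sum fun e _ => ?_)
          rw [abs_mul, abs_mul, abs_mul]
          have := hn u a
          have := hn v b
          have := hn w e
          have := hb a b e
          gcongr
      _ = _ := by simp; ring
  refine ContinuousLinearMap.opNorm_le_bound _ (by positivity) fun u => ?_
  refine ContinuousLinearMap.opNorm_le_bound _ (by positivity) fun v => ?_
  have := key u v (fderiv ℝ (hessCLM g) x u v)
  rw [real_inner_self_eq_norm_sq, abs_of_nonneg (by positivity)] at this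
  rcases eq_or_lt_of_le (norm_nonneg (fderiv ℝ (hessCLM g) x u v)) with h0 | h0
  · rw [← h0]; positivity
  · rw [pow_two] at this
    exact le_of_mul_le_mul_right this h0

lemma aux_coercive {K : ℕ} (A : EuclideanSpace ℝ (Fin K) →L[ℝ] EuclideanSpace ℝ (Fin K)) (m : ℝ)
    (hm : ∀ v, m * ‖v‖ ^ 2 ≤ ⟪A v, v⟫) (v : EuclideanSpace ℝ (Fin K)) : m * ‖v‖ ≤ ‖A v‖ := by
  rcases eq_or_lt_of_le (norm_nonneg v) with h0 | h0
  · rw [← h0]; simp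
  · have h1 := (hm v).trans (real_inner_le_norm _ _)
    rw [pow_two, ← mul_assoc] at h1
    exact le_of_mul_le_mul_right h1 h0

lemma aux_isUnit {K : ℕ} (A : EuclideanSpace ℝ (Fin K) →L[ℝ] EuclideanSpace ℝ (Fin K)) (m : ℝ)
    (hm0 : 0 < m) (hm : ∀ v, m * ‖v‖ ^ 2 ≤ ⟪A v, v⟫) : IsUnit A := by
  have inj : Function.Injective A := by
    rw [injective_iff_map_eq_zero]
    intro v hv
    have := aux_coercive A m hm v
    rw [hv, norm_zero] at this
    have : ‖v‖ ≤ 0 := by nlinarith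
    simpa using this
  rw [ContinuousLinearMap.isUnit_iff_bijective]
  exact ⟨inj, (LinearMap.injective_iff_surjective (f := (A : EuclideanSpace ℝ (Fin K) →ₗ[ℝ] EuclideanSpace ℝ (Fin K)))).1 inj⟩

/-- abstract core -/
lemma aux_core {K : ℕ} (F g : EuclideanSpace ℝ (Fin K) → ℝ) (hF : ContDiff ℝ 3 F)
    (hg : ContDiff ℝ 3 g) (m M L T : ℝ) (hm : 0 < m) (hM : 0 ≤ M) (hL : 0 ≤ L) (hT : 0 ≤ T)
    (γ : ℝ → EuclideanSpace ℝ (Fin K)) (hγ : ContDiffOn ℝ 2 γ (Icc (-1 : ℝ) 0))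
    (hmin : ∀ τ ∈ Icc (-1 : ℝ) 0, ∀ y, F (γ τ) + τ * g (γ τ) ≤ F y + τ * g y)
    (hgM : ∀ τ ∈ Icc (-1 : ℝ) 0, ‖gradient g (γ τ)‖ ≤ M)
    (hgL : ∀ τ ∈ Icc (-1 : ℝ) 0, ‖hessCLM g (γ τ)‖ ≤ L)
    (hFT : ∀ τ ∈ Icc (-1 : ℝ) 0, ‖fderiv ℝ (hessCLM F) (γ τ)‖ ≤ T)
    (hconv : ∀ τ ∈ Icc (-1 : ℝ) 0, ∀ x v,
      m * ‖v‖ ^ 2 ≤ ⟪(hessCLM F x + τ • hessCLM g x) v, v⟫) :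
    ‖γ (-1) - γ 0 - (Ring.inverse (hessCLM F (γ 0))) (gradient g (γ 0))‖
      ≤ ((T * (M / m) + L) * (M / m) + L * (M / m)) / m := by
  have hI0 : (0:ℝ) ∈ Icc (-1 : ℝ) 0 := by simp
  have hI1 : (-1:ℝ) ∈ Icc (-1 : ℝ) 0 := by simp
  have hcv : Convex ℝ (Icc (-1 : ℝ) 0) := convex_Icc _ _
  set V := M / m with hV
  have hV0 : 0 ≤ V := by positivity
  set v : ℝ → EuclideanSpace ℝ (Fin K) := fun τ => derivWithin γ (Icc (-1) 0) τ with hv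
  have hdγ : ∀ τ ∈ Icc (-1 : ℝ) 0, HasDerivWithinAt γ (v τ) (Icc (-1) 0) τ := fun τ hτ =>
    ((hγ.differentiableOn (by norm_num)) τ hτ).hasDerivWithinAt
  have hfoc : ∀ τ ∈ Icc (-1 : ℝ) 0, gradient F (γ τ) + τ • gradient g (γ τ) = 0 := by
    intro τ hτ
    have hlm : IsLocalMin (fun y => F y + τ * g y) (γ τ) :=
      Filter.Eventually.of_forall fun y => hmin τ hτ y
    have hd : HasFDerivAt (fun y => F y + τ * g y) (fderiv ℝ F (γ τ) + τ • fderiv ℝ g (γ τ)) (γ τ) :=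
      ((hF.differentiable (by norm_num)) _).hasFDerivAt.add
        (((hg.differentiable (by norm_num)) _).hasFDerivAt.const_mul τ)
    have := hlm.hasFDerivAt_eq_zero hd
    have h2 := congrArg (InnerProductSpace.toDual ℝ (EuclideanSpace ℝ (Fin K))).symm this
    simpa [gradient] using h2
  have hdgF : ∀ τ ∈ Icc (-1 : ℝ) 0, HasDerivWithinAt (fun t => gradient F (γ t))
      (hessCLM F (γ τ) (v τ)) (Icc (-1) 0) τ := fun τ hτ =>
    (aux_grad_hasFDerivAt hF (γ τ)).comp_hasDerivWithinAt τ (hdγ τ hτ)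
  have hdgg : ∀ τ ∈ Icc (-1 : ℝ) 0, HasDerivWithinAt (fun t => gradient g (γ t))
      (hessCLM g (γ τ) (v τ)) (Icc (-1) 0) τ := fun τ hτ =>
    (aux_grad_hasFDerivAt hg (γ τ)).comp_hasDerivWithinAt τ (hdγ τ hτ)
  have hdH : ∀ τ ∈ Icc (-1 : ℝ) 0, HasDerivWithinAt (fun t => hessCLM F (γ t))
      (fderiv ℝ (hessCLM F) (γ τ) (v τ)) (Icc (-1) 0) τ := fun τ hτ =>
    (aux_hess_hasFDerivAt hF (γ τ)).comp_hasDerivWithinAt τ (hdγ τ hτ)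
  have hode : ∀ τ ∈ Icc (-1 : ℝ) 0,
      (hessCLM F (γ τ) + τ • hessCLM g (γ τ)) (v τ) = - gradient g (γ τ) := by
    intro τ hτ
    have h1 := (hdgF τ hτ).fun_add ((hasDerivWithinAt_id τ (Icc (-1) 0)).fun_smul (hdgg τ hτ))
    have h2 : HasDerivWithinAt (fun _ : ℝ => (0 : EuclideanSpace ℝ (Fin K))) 0 (Icc (-1) 0) τ :=
      hasDerivWithinAt_const _ _ _
    have h3 := h2.congr (f₁ := fun t => gradient F (γ t) + id t • gradient g (γ t))
      (fun t ht => hfoc t ht) (hfoc τ hτ)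
    have h4 := (uniqueDiffOn_Icc (by norm_num : (-1:ℝ) < 0) τ hτ).eq_deriv _ h1 h3
    simp only [id, one_smul] at h4
    rw [eq_neg_iff_add_eq_zero, ← h4]
    simp [add_assoc]
  have hvV : ∀ τ ∈ Icc (-1 : ℝ) 0, ‖v τ‖ ≤ V := by
    intro τ hτ
    have := aux_coercive _ m (hconv τ hτ (γ τ)) (v τ)
    rw [hode τ hτ, norm_neg] at this
    rw [hV, le_div_iff₀ hm, mul_comm]
    exact this.trans (hgM τ hτ)
  have habs : ∀ τ ∈ Icc (-1 : ℝ) 0, ‖τ - 0‖ ≤ 1 := by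
    intro τ hτ
    rw [sub_zero, Real.norm_eq_abs, abs_le]; constructor <;> linarith [hτ.1, hτ.2]
  have hHd : ∀ τ ∈ Icc (-1 : ℝ) 0, ‖hessCLM F (γ τ) - hessCLM F (γ 0)‖ ≤ T * V := by
    intro τ hτ
    have := hcv.norm_image_sub_le_of_norm_hasDerivWithin_le (C := T * V) hdH
      (fun t ht => (ContinuousLinearMap.le_opNorm _ _).trans
        (mul_le_mul (hFT t ht) (hvV t ht) (norm_nonneg _) hT)) hI0 hτ
    exact this.trans (mul_le_of_le_one_right (by positivity) (habs τ hτ))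
  have hgd : ∀ τ ∈ Icc (-1 : ℝ) 0, ‖gradient g (γ τ) - gradient g (γ 0)‖ ≤ L * V := by
    intro τ hτ
    have := hcv.norm_image_sub_le_of_norm_hasDerivWithin_le (C := L * V) hdgg
      (fun t ht => (ContinuousLinearMap.le_opNorm _ _).trans
        (mul_le_mul (hgL t ht) (hvV t ht) (norm_nonneg _) hL)) hI0 hτ
    exact this.trans (mul_le_of_le_one_right (by positivity) (habs τ hτ))
  set H := hessCLM F (γ 0) with hH
  set R := (T * V + L) * V + L * V with hR
  have hR0 : 0 ≤ R := by positivity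
  have hdφ : ∀ τ ∈ Icc (-1 : ℝ) 0, HasDerivWithinAt (fun t => H (γ t) + t • gradient g (γ 0))
      (H (v τ) + gradient g (γ 0)) (Icc (-1) 0) τ := by
    intro τ hτ
    have h1 := H.hasFDerivAt.comp_hasDerivWithinAt τ (hdγ τ hτ)
    have h2 := (hasDerivWithinAt_id τ (Icc (-1) 0)).smul_const (gradient g (γ 0))
    simpa using h1.fun_add h2
  have hbφ : ∀ τ ∈ Icc (-1 : ℝ) 0, ‖H (v τ) + gradient g (γ 0)‖ ≤ R := by
    intro τ hτ
    have e : H (v τ) + gradient g (γ 0) = -((hessCLM F (γ τ) - H + τ • hessCLM g (γ τ)) (v τ))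
        - (gradient g (γ τ) - gradient g (γ 0)) := by
      have := hode τ hτ
      have e2 : gradient g (γ τ) = - (hessCLM F (γ τ) + τ • hessCLM g (γ τ)) (v τ) := by
        rw [this, neg_neg]
      rw [e2]
      simp only [add_apply, sub_apply]
      abel
    rw [e]
    refine (norm_sub_le _ _).trans (add_le_add ?_ (hgd τ hτ))
    rw [norm_neg]
    refine (ContinuousLinearMap.le_opNorm _ _).trans ?_
    refine mul_le_mul ?_ (hvV τ hτ) (norm_nonneg _) (by positivity)
    refine (norm_add_le _ _).trans (add_le_add (hHd τ hτ) ?_)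
    rw [norm_smul]
    have := habs τ hτ
    rw [sub_zero] at this
    exact (mul_le_of_le_one_left (norm_nonneg _) this).trans (hgL τ hτ)
  have hfin := hcv.norm_image_sub_le_of_norm_hasDerivWithin_le (C := R) hdφ hbφ hI0 hI1
  have hco : ∀ v, m * ‖v‖ ^ 2 ≤ ⟪H v, v⟫ := by
    intro v; simpa using hconv 0 hI0 (γ 0) v
  have hU := aux_isUnit H m hm hco
  have hinv : H ((Ring.inverse H) (gradient g (γ 0))) = gradient g (γ 0) := by
    have := DFunLike.congr_fun (Ring.mul_inverse_cancel H hU) (gradient g (γ 0))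
    simpa using this
  have hlast := aux_coercive H m hco (γ (-1) - γ 0 - (Ring.inverse H) (gradient g (γ 0)))
  rw [le_div_iff₀ hm, mul_comm]
  refine hlast.trans ?_
  rw [map_sub, map_sub, hinv]
  have e : H (γ (-1)) - H (γ 0) - gradient g (γ 0) =
    H (γ (-1)) + (-1:ℝ) • gradient g (γ 0) - (H (γ 0) + (0:ℝ) • gradient g (γ 0)) := by
    rw [neg_one_smul, zero_smul]; abel
  rw [e]
  simpa using hfin

/-- For fixed `K ≥ 1`, `ĉ > 0`, `M, L, M₃ ≥ 0` there is a constant `C`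
(depending only on these data) such that for every `n ≥ 2`, data set, index `j`, if each
`h(·, zᵢ)` is `ĉ`-strongly convex, `∇²f ⪰ 0`, a `C²` curve `γ̂ : [−1,0] → ℝ^K` globally
minimizes each `F_τ = F + τ·h(·, z_j)`, and the stated first/second/third order bounds hold
along the curve, then with `γ_S = γ̂(0)` and `γ_{S∖{z_j}} = γ̂(−1)`,
`‖γ_{S∖{z_j}} − γ_S − (∇²F(γ_S))⁻¹ ∇h(γ_S, z_j)‖ ≤ C/n²`. -/
theorem stmt_5 (K : ℕ) (hK : 1 ≤ K) (c M L M₃ : ℝ)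
    (hc : 0 < c) (hM : 0 ≤ M) (hL : 0 ≤ L) (hM₃ : 0 ≤ M₃) :
    ∃ C : ℝ, ∀ (Z : Type) (n : ℕ), 2 ≤ n →
      ∀ (z : Fin n → Z) (j : Fin n)
        (h : EuclideanSpace ℝ (Fin K) → Z → ℝ) (f : EuclideanSpace ℝ (Fin K) → ℝ),
        ContDiff ℝ 3 f →
        (∀ i, ContDiff ℝ 3 (fun γ => h γ (z i))) →
        (∀ i, StrongConvexHess c (fun γ => h γ (z i))) →
        StrongConvexHess 0 f →
        ∀ γhat : ℝ → EuclideanSpace ℝ (Fin K),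
        ContDiffOn ℝ 2 γhat (Icc (-1 : ℝ) 0) →
        (∀ τ ∈ Icc (-1 : ℝ) 0, ∀ γ,
          (∑ i, h (γhat τ) (z i)) + f (γhat τ) + τ * h (γhat τ) (z j)
            ≤ (∑ i, h γ (z i)) + f γ + τ * h γ (z j)) →
        (∀ τ ∈ Icc (-1 : ℝ) 0, ‖gradient (fun γ => h γ (z j)) (γhat τ)‖ ≤ M) →
        (∀ τ ∈ Icc (-1 : ℝ) 0, ‖hessCLM (fun γ => h γ (z j)) (γhat τ)‖ ≤ L) →
        (∀ τ ∈ Icc (-1 : ℝ) 0, ∀ a b e : Fin K,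
          |iteratedFDeriv ℝ 3 f (γhat τ)
              ![EuclideanSpace.single a (1 : ℝ), EuclideanSpace.single b (1 : ℝ),
                EuclideanSpace.single e (1 : ℝ)]| ≤ M₃) →
        (∀ i, ∀ τ ∈ Icc (-1 : ℝ) 0, ∀ a b e : Fin K,
          |iteratedFDeriv ℝ 3 (fun γ => h γ (z i)) (γhat τ)
              ![EuclideanSpace.single a (1 : ℝ), EuclideanSpace.single b (1 : ℝ),
                EuclideanSpace.single e (1 : ℝ)]| ≤ M₃) →
        ‖γhat (-1) - γhat 0
            - (Ring.inverse (hessCLM (fun γ => (∑ i, h γ (z i)) + f γ) (γhat 0)))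
                (gradient (fun γ => h γ (z j)) (γhat 0))‖
          ≤ C / (n : ℝ) ^ 2 := by
  refine ⟨((((K:ℝ)^3*M₃*2*(2*M/c) + L) * (2*M/c) + L*(2*M/c)) * 2 / c), ?_⟩
  intro Z n hn z j h f hf hh hsc hfc γ hγ hmin hgM hgL hf3 hh3
  have hn' : (2:ℝ) ≤ n := by exact_mod_cast hn
  have hF : ContDiff ℝ 3 (fun γ => (∑ i, h γ (z i)) + f γ) :=
    (ContDiff.sum fun i _ => hh i).add hf
  have hm : 0 < (n:ℝ) * c / 2 := by positivity
  have hfd : ∀ x, fderiv ℝ (fun γ => (∑ i, h γ (z i)) + f γ) x =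
      (∑ i, fderiv ℝ (fun γ => h γ (z i)) x) + fderiv ℝ f x := by
    intro x
    exact ((HasFDerivAt.fun_sum fun i _ =>
      (((hh i).differentiable (by norm_num)) x).hasFDerivAt).add
      ((hf.differentiable (by norm_num)) x).hasFDerivAt).fderiv
  have hfd2 : ∀ x, fderiv ℝ (fderiv ℝ (fun γ => (∑ i, h γ (z i)) + f γ)) x =
      (∑ i, fderiv ℝ (fderiv ℝ (fun γ => h γ (z i))) x) + fderiv ℝ (fderiv ℝ f) x := by
    intro x
    rw [funext hfd]
    have hd : ∀ {g : EuclideanSpace ℝ (Fin K) → ℝ}, ContDiff ℝ 3 g →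
        HasFDerivAt (fderiv ℝ g) (fderiv ℝ (fderiv ℝ g) x) x := by
      intro g hg
      have h1 : ContDiff ℝ 2 (fderiv ℝ g) := hg.fderiv_right (by norm_num)
      exact ((h1.differentiable (by norm_num)) x).hasFDerivAt
    exact ((HasFDerivAt.fun_sum fun i _ => hd (hh i)).add (hd hf)).fderiv
  have key := aux_core (fun γ => (∑ i, h γ (z i)) + f γ) (fun γ => h γ (z j)) hF (hh j)
    ((n:ℝ) * c / 2) M L ((K:ℝ)^3 * ((n+1) * M₃)) hm hM hL (by positivity) γ hγ hmin hgM hgL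
    ?_ ?_
  · refine key.trans ?_
    have e1 : M / ((n:ℝ) * c / 2) = (2*M/c) / n := by field_simp
    rw [e1]
    set W := 2*M/c with hW
    have hW0 : 0 ≤ W := by positivity
    have h1 : (K:ℝ)^3 * ((n+1) * M₃) * (W / n) ≤ (K:ℝ)^3*M₃*2*W := by
      rw [← mul_div_assoc, div_le_iff₀ (by positivity)]
      have : 0 ≤ (K:ℝ)^3 * M₃ * W := by positivity
      nlinarith
    calc _ ≤ (((K:ℝ)^3*M₃*2*W + L) * (W/n) + L * (W/n)) / ((n:ℝ) * c / 2) := by gcongr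
      _ = _ := by field_simp
  · intro τ hτ
    refine aux_third_bound _ _ (by positivity) (fun a b e => ?_) hF
    have hit : iteratedFDeriv ℝ 3 (fun γ => (∑ i, h γ (z i)) + f γ) (γ τ) =
        (∑ i, iteratedFDeriv ℝ 3 (fun γ => h γ (z i)) (γ τ)) + iteratedFDeriv ℝ 3 f (γ τ) := by
      have hs : ContDiff ℝ 3 (fun γ => ∑ i, h γ (z i)) := ContDiff.sum fun i _ => hh i
      rw [fun_iteratedFDeriv_add_apply hs.contDiffAt hf.contDiffAt]
      congr 1
      rw [iteratedFDeriv_fun_sum_apply fun i _ => (hh i).contDiffAt]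
    rw [hit, add_apply, sum_apply]
    refine (abs_add_le _ _).trans ?_
    have h1 := (Finset.abs_sum_le_sum_abs (fun i => iteratedFDeriv ℝ 3 (fun γ => h γ (z i)) (γ τ)
      ![EuclideanSpace.single a (1 : ℝ), EuclideanSpace.single b (1 : ℝ),
                EuclideanSpace.single e (1 : ℝ)]) Finset.univ).trans
      (Finset.sum_le_sum fun i _ => hh3 i τ hτ a b e)
    have h2 := hf3 τ hτ a b e
    simp only [Finset.sum_const, Finset.card_univ, Fintype.card_fin, nsmul_eq_mul] at h1
    linarith
  · intro τ hτ x v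
    rw [add_apply, smul_apply, inner_add_left,
      real_inner_smul_left, aux_hess_inner hF, hfd2]
    simp only [add_apply, sum_apply]
    rw [← aux_hess_inner hf, Finset.sum_congr rfl fun i _ => (aux_hess_inner (hh i) x v v).symm,
      ← Finset.add_sum_erase _ _ (Finset.mem_univ j)]
    have h1 : ∑ i ∈ Finset.univ.erase j, c * ‖v‖^2 ≤
      ∑ i ∈ Finset.univ.erase j, ⟪hessCLM (fun γ => h γ (z i)) x v, v⟫ :=
      Finset.sum_le_sum fun i _ => hsc i x v
    rw [Finset.sum_const, Finset.card_erase_of_mem (Finset.mem_univ j), Finset.card_univ,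
      Fintype.card_fin, nsmul_eq_mul, Nat.cast_sub (by omega), Nat.cast_one] at h1
    have h2 := hfc x v
    have h3 := hsc j x v
    have hq : 0 ≤ c * ‖v‖^2 := by positivity
    have h4 : 0 ≤ (1 + τ) * ⟪hessCLM (fun γ => h γ (z j)) x v, v⟫ :=
      mul_nonneg (by linarith [hτ.1]) (hq.trans h3)
    nlinarith
end
end

section
/- Fix K ≥ 1, m ≥ 1 and constants ĉ > 0, M ≥ 0, L ≥ 0, M₃ ≥ 0. There exists a constant C, depending only on K, m, ĉ, M, L and M₃, with the following property. For every n ≥ m + 1, data z_1,…,z_n, and subset S′ ⊆ {z_1,…,z_n} with |S′| = m, suppose (i) each γ ↦ h(γ, z_i) is ĉ-strongly convex and ∇²f(γ) ⪰ 0 for all γ, and there is a twice continuously differentiable curve γ̂ : [−1, 0] → ℝ^K such that for each τ ∈ [−1, 0], γ̂(τ) is the global minimizer of γ ↦ F(γ) + τ·Σ_{z ∈ S′} h(γ, z); suppose further (ii) for every z ∈ S′ and τ ∈ [−1, 0], ‖∇_γ h(γ̂(τ), z)‖ ≤ M and ‖∇²_γ h(γ̂(τ), z)‖ ≤ L, and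 all third-order partial derivatives in γ of f and of each h(·, z_i) are bounded in absolute value by M₃ at every point γ̂(τ). Let γ_S = γ̂(0) be the global minimizer of F and γ_{S−S′} = γ̂(−1) be the global minimizer of γ ↦ F(γ) − Σ_{z ∈ S′} h(γ, z). Then ‖γ_{S−S′} − γ_S − (∇²_γ F(γ_S))^{−1} · Σ_{z ∈ S′} ∇_γ h(γ_S, z)‖ ≤ C/n². -/
open Set
open scoped RealInnerProductSpace

noncomputable section

abbrev EE (K : ℕ) := EuclideanSpace ℝ (Fin K)

lemma grad_fun_eq {K : ℕ} (g : EE K → ℝ) :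
    gradient g = fun x => (InnerProductSpace.toDual ℝ (EE K)).symm (fderiv ℝ g x) := rfl

lemma contDiff_grad {K : ℕ} {g : EE K → ℝ} (hg : ContDiff ℝ 3 g) : ContDiff ℝ 2 (gradient g) := by
  rw [grad_fun_eq]
  exact (InnerProductSpace.toDual ℝ (EE K)).symm.contDiff.comp
    (hg.fderiv_right (m := 2) (by norm_num))

lemma hess_inner {K : ℕ} {g : EE K → ℝ} (hg : ContDiff ℝ 3 g) (x u v : EE K) :
    ⟪hessCLM g x u, v⟫ = iteratedFDeriv ℝ 2 g x ![u, v] := by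
  rw [iteratedFDeriv_two_apply, hessCLM, grad_fun_eq]
  have h1 : DifferentiableAt ℝ (fderiv ℝ g) x :=
    ((hg.fderiv_right (m := 2) (by norm_num)).differentiable (by norm_num)) x
  have h2 := ((InnerProductSpace.toDual ℝ (EE K)).symm.toContinuousLinearEquiv.toContinuousLinearMap.hasFDerivAt (x := fderiv ℝ g x)).comp x h1.hasFDerivAt
  have h3 : HasFDerivAt (fun x => (InnerProductSpace.toDual ℝ (EE K)).symm (fderiv ℝ g x)) _ x := h2
  rw [h3.fderiv]
  simp

lemma hess_sub_le {K : ℕ} {g : EE K → ℝ} (hg : ContDiff ℝ 3 g) (x y : EE K) :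
    ‖hessCLM g x - hessCLM g y‖ ≤ ‖iteratedFDeriv ℝ 2 g x - iteratedFDeriv ℝ 2 g y‖ := by
  refine ContinuousLinearMap.opNorm_le_bound _ (norm_nonneg _) fun u => ?_
  set w := (hessCLM g x - hessCLM g y) u with hw
  have h1 : ‖w‖ ^ 2 = (iteratedFDeriv ℝ 2 g x - iteratedFDeriv ℝ 2 g y) ![u, w] := by
    rw [← real_inner_self_eq_norm_sq]
    have e : ⟪w, w⟫ = ⟪hessCLM g x u - hessCLM g y u, w⟫ := rfl
    rw [e, inner_sub_left, hess_inner hg, hess_inner hg]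
    rfl
  have h2 := (iteratedFDeriv ℝ 2 g x - iteratedFDeriv ℝ 2 g y).le_opNorm ![u, w]
  rw [← h1] at h2
  simp only [Fin.prod_univ_two, Matrix.cons_val_zero, Matrix.cons_val_one, Real.norm_eq_abs, abs_pow, abs_norm] at h2
  by_cases hw0 : ‖w‖ = 0
  · rw [hw0]; positivity
  · have : 0 < ‖w‖ := lt_of_le_of_ne (norm_nonneg _) (Ne.symm hw0)
    nlinarith

lemma tri_bound {K : ℕ} {M₃ : ℝ} (hM₃ : 0 ≤ M₃)
    (T : ContinuousMultilinearMap ℝ (fun _ : Fin 3 => EE K) ℝ)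
    (hT : ∀ a b e : Fin K, |T ![EuclideanSpace.single a (1 : ℝ), EuclideanSpace.single b (1 : ℝ),
                EuclideanSpace.single e (1 : ℝ)]| ≤ M₃) : ‖T‖ ≤ (K:ℝ)^3 * M₃ := by
  refine ContinuousMultilinearMap.opNorm_le_bound (by positivity) fun w => ?_
  have hw : w = fun j => ∑ a : Fin K, (w j a) • EuclideanSpace.single a (1:ℝ) := by
    funext j
    ext b
    simp [Finset.sum_apply, Pi.single_apply]
  have e1 : T w = ∑ r : Fin 3 → Fin K, (∏ j, w j (r j)) * T (fun j => EuclideanSpace.single (r j) (1:ℝ)) := by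
    conv_lhs => rw [hw]
    rw [ContinuousMultilinearMap.map_sum]
    refine Finset.sum_congr rfl fun r _ => ?_
    rw [ContinuousMultilinearMap.map_smul_univ]; rfl
  rw [e1]
  refine (norm_sum_le _ _).trans ?_
  have : ∀ r ∈ (Finset.univ : Finset (Fin 3 → Fin K)), ‖(∏ j, w j (r j)) * T (fun j => EuclideanSpace.single (r j) (1:ℝ))‖ ≤ (∏ j, ‖w j‖) * M₃ := by
    intro r _
    rw [norm_mul, norm_prod]
    have e2 : (fun j => EuclideanSpace.single (r j) (1:ℝ)) = ![EuclideanSpace.single (r 0) (1 : ℝ), EuclideanSpace.single (r 1) (1 : ℝ),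
                EuclideanSpace.single (r 2) (1 : ℝ)] := by
      funext j; fin_cases j <;> rfl
    rw [e2]
    gcongr with j
    · exact PiLp.norm_apply_le (w j) (r j)
    · exact hT _ _ _
  refine (Finset.sum_le_card_nsmul _ _ _ this).trans (le_of_eq ?_)
  simp; ring

lemma hess_curve {K : ℕ} {M₃ R : ℝ} (hM₃ : 0 ≤ M₃) {g : EE K → ℝ} (hg : ContDiff ℝ 3 g)
    (γ γ' : ℝ → EE K) (hγ : ∀ t ∈ Icc (-1:ℝ) 0, HasDerivWithinAt γ (γ' t) (Icc (-1) 0) t)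
    (hR : ∀ t ∈ Icc (-1:ℝ) 0, ‖γ' t‖ ≤ R)
    (hT : ∀ t ∈ Icc (-1:ℝ) 0, ∀ a b e : Fin K, |iteratedFDeriv ℝ 3 g (γ t) ![EuclideanSpace.single a (1 : ℝ), EuclideanSpace.single b (1 : ℝ),
                EuclideanSpace.single e (1 : ℝ)]| ≤ M₃) (t : ℝ) (ht : t ∈ Icc (-1:ℝ) 0) :
    ‖hessCLM g (γ 0) - hessCLM g (γ t)‖ ≤ (K:ℝ)^3 * M₃ * R := by
  refine (hess_sub_le hg _ _).trans ?_
  have h0 : (0:ℝ) ∈ Icc (-1:ℝ) 0 := by simp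
  have hR0 : 0 ≤ R := (norm_nonneg _).trans (hR 0 h0)
  have key := (convex_Icc (-1:ℝ) 0).norm_image_sub_le_of_norm_hasDerivWithin_le
    (f := fun t => iteratedFDeriv ℝ 2 g (γ t))
    (f' := fun t => fderiv ℝ (iteratedFDeriv ℝ 2 g) (γ t) (γ' t)) (C := (K:ℝ)^3 * M₃ * R)
    (fun t ht => ?_) (fun t ht => ?_) ht h0
  · refine key.trans ?_
    have : ‖0 - t‖ ≤ 1 := by
      rw [Real.norm_eq_abs, abs_le]; constructor <;> linarith [ht.1, ht.2]
    exact mul_le_of_le_one_right (by positivity) this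
  · have hd : DifferentiableAt ℝ (iteratedFDeriv ℝ 2 g) (γ t) :=
      (hg.differentiable_iteratedFDeriv (m := 2) (by norm_cast)) _
    exact hd.hasFDerivAt.comp_hasDerivWithinAt t (hγ t ht)
  · refine (ContinuousLinearMap.le_opNorm _ _).trans ?_
    rw [norm_fderiv_iteratedFDeriv]
    have := tri_bound hM₃ _ (hT t ht)
    have := hR t ht
    gcongr

lemma coer_bound {K : ℕ} {a P : ℝ} (ha : 0 < a) (A : EE K →L[ℝ] EE K)
    (hA : ∀ v, a * ‖v‖ ^ 2 ≤ ⟪A v, v⟫) (v : EE K) (hv : ‖A v‖ ≤ P) : ‖v‖ ≤ P / a := by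
  rw [le_div_iff₀ ha]
  have h1 := hA v
  have h2 := real_inner_le_norm (A v) v
  by_cases hw0 : ‖v‖ = 0
  · rw [hw0]; linarith [norm_nonneg (A v)]
  · have : 0 < ‖v‖ := lt_of_le_of_ne (norm_nonneg _) (Ne.symm hw0)
    nlinarith

lemma coer_unit {K : ℕ} {a : ℝ} (ha : 0 < a) (A : EE K →L[ℝ] EE K)
    (hA : ∀ v, a * ‖v‖ ^ 2 ≤ ⟪A v, v⟫) : IsUnit A := by
  rw [ContinuousLinearMap.isUnit_iff_bijective]
  have hinj : Function.Injective (A : EE K →ₗ[ℝ] EE K) := by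
    rw [injective_iff_map_eq_zero]
    intro v hv
    have := coer_bound (P := 0) ha A hA v (by simpa using hv)
    simpa using this
  exact ⟨hinj, LinearMap.injective_iff_surjective.1 hinj⟩

lemma core_deriv {K : ℕ} (Φ Ψ : EE K → EE K) (hΦ : Differentiable ℝ Φ) (hΨ : Differentiable ℝ Ψ)
    (γ γ' : ℝ → EE K) (hγ : ∀ t ∈ Icc (-1:ℝ) 0, HasDerivWithinAt γ (γ' t) (Icc (-1) 0) t)
    (hz : ∀ t ∈ Icc (-1:ℝ) 0, Φ (γ t) + t • Ψ (γ t) = 0) (t : ℝ) (ht : t ∈ Icc (-1:ℝ) 0) :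
    (fderiv ℝ Φ (γ t) + t • fderiv ℝ Ψ (γ t)) (γ' t) = - Ψ (γ t) := by
  have h1 := (hΦ (γ t)).hasFDerivAt.comp_hasDerivWithinAt t (hγ t ht)
  have h2 := (hΨ (γ t)).hasFDerivAt.comp_hasDerivWithinAt t (hγ t ht)
  have h3 := h1.add ((hasDerivWithinAt_id t _).smul h2)
  have h4 : HasDerivWithinAt (fun _ : ℝ => (0 : EE K)) 0 (Icc (-1) 0) t :=
    hasDerivWithinAt_const _ _ _
  have h5 := h3.congr_of_mem (f₁ := fun _ : ℝ => (0 : EE K)) (fun x hx => (hz x hx).symm) ht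
  have h6 := UniqueDiffWithinAt.eq_deriv _ ((uniqueDiffOn_Icc (by norm_num : (-1:ℝ) < 0)) t ht) h5 h4
  simp only [id, one_smul, Function.comp] at h6
  simp only [add_apply, smul_apply]
  rw [eq_neg_iff_add_eq_zero, ← h6]; abel

lemma core {K : ℕ} {a P Q D : ℝ} (ha : 0 < a) (hP : 0 ≤ P) (hQ : 0 ≤ Q) (hD0 : 0 ≤ D)
    (Φ Ψ : EE K → EE K) (hΦ : Differentiable ℝ Φ) (hΨ : Differentiable ℝ Ψ)
    (γ γ' : ℝ → EE K) (hγ : ∀ t ∈ Icc (-1:ℝ) 0, HasDerivWithinAt γ (γ' t) (Icc (-1) 0) t)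
    (hz : ∀ t ∈ Icc (-1:ℝ) 0, Φ (γ t) + t • Ψ (γ t) = 0)
    (hco : ∀ v, a * ‖v‖ ^ 2 ≤ ⟪fderiv ℝ Φ (γ 0) v, v⟫)
    (hR : ∀ t ∈ Icc (-1:ℝ) 0, ‖γ' t‖ ≤ P)
    (hHQ : ∀ t ∈ Icc (-1:ℝ) 0, ‖fderiv ℝ Ψ (γ t)‖ ≤ Q)
    (hD : ∀ t ∈ Icc (-1:ℝ) 0, ‖fderiv ℝ Φ (γ 0) - fderiv ℝ Φ (γ t)‖ ≤ D) :
    ‖γ (-1) - γ 0 - Ring.inverse (fderiv ℝ Φ (γ 0)) (Ψ (γ 0))‖ ≤ (D * P + 2 * Q * P) / a := by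
  have h0 : (0:ℝ) ∈ Icc (-1:ℝ) 0 := by simp
  have h1 : (-1:ℝ) ∈ Icc (-1:ℝ) 0 := by simp
  have hd := core_deriv Φ Ψ hΦ hΨ γ γ' hγ hz
  have hd0 : fderiv ℝ Φ (γ 0) (γ' 0) = - Ψ (γ 0) := by simpa using hd 0 h0
  have hinv : Ring.inverse (fderiv ℝ Φ (γ 0)) (Ψ (γ 0)) = - γ' 0 := by
    have := Ring.inverse_mul_cancel _ (coer_unit ha _ hco)
    have h2 := congrArg (fun T : EE K →L[ℝ] EE K => T (γ' 0)) this
    simp only [mul_apply_eq_comp, hd0, map_neg, one_apply_eq_self] at h2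
    rw [← h2, neg_neg]
  rw [hinv]
  have habs : ∀ t ∈ Icc (-1:ℝ) 0, |t| ≤ 1 := fun t ht => by
    rw [abs_le]; constructor <;> linarith [ht.1, ht.2]
  have hPsi : ∀ t ∈ Icc (-1:ℝ) 0, ‖Ψ (γ 0) - Ψ (γ t)‖ ≤ Q * P := by
    intro t ht
    have key := (convex_Icc (-1:ℝ) 0).norm_image_sub_le_of_norm_hasDerivWithin_le
      (f := fun t => Ψ (γ t))
      (f' := fun t => fderiv ℝ Ψ (γ t) (γ' t)) (C := Q * P)
      (fun t ht => (hΨ (γ t)).hasFDerivAt.comp_hasDerivWithinAt t (hγ t ht)) (fun t ht => ?_) ht h0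
    · refine key.trans (mul_le_of_le_one_right (by positivity) ?_)
      rw [zero_sub, norm_neg]; exact habs t ht
    · exact (ContinuousLinearMap.le_opNorm _ _).trans (mul_le_mul (hHQ t ht) (hR t ht) (norm_nonneg _) hQ)
  have hdiff : ∀ t ∈ Icc (-1:ℝ) 0, ‖γ' t - γ' 0‖ ≤ (D * P + 2 * Q * P) / a := by
    intro t ht
    refine coer_bound ha _ hco _ ?_
    have e : fderiv ℝ Φ (γ 0) (γ' t - γ' 0) =
        (fderiv ℝ Φ (γ 0) - fderiv ℝ Φ (γ t)) (γ' t) - t • (fderiv ℝ Ψ (γ t) (γ' t))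
          + (Ψ (γ 0) - Ψ (γ t)) := by
      have := hd t ht
      simp only [add_apply, smul_apply] at this
      rw [map_sub, hd0, sub_apply, eq_sub_of_add_eq this]
      abel
    rw [e]
    have i1 : ‖(fderiv ℝ Φ (γ 0) - fderiv ℝ Φ (γ t)) (γ' t)‖ ≤ D * P :=
      (ContinuousLinearMap.le_opNorm _ _).trans (mul_le_mul (hD t ht) (hR t ht) (norm_nonneg _) hD0)
    have i2 : ‖t • (fderiv ℝ Ψ (γ t) (γ' t))‖ ≤ Q * P := by
      rw [norm_smul]
      exact (mul_le_of_le_one_left (norm_nonneg _) (habs t ht)).trans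
        ((ContinuousLinearMap.le_opNorm _ _).trans (mul_le_mul (hHQ t ht) (hR t ht) (norm_nonneg _) hQ))
    have i3 := hPsi t ht
    refine (norm_add_le _ _).trans ?_
    have := norm_sub_le ((fderiv ℝ Φ (γ 0) - fderiv ℝ Φ (γ t)) (γ' t)) (t • (fderiv ℝ Ψ (γ t) (γ' t)))
    linarith
  have key := (convex_Icc (-1:ℝ) 0).norm_image_sub_le_of_norm_hasDerivWithin_le
      (f := fun t => γ t - t • γ' 0)
      (f' := fun t => γ' t - γ' 0)
      (fun t ht => by
        simpa using (hγ t ht).fun_sub ((hasDerivWithinAt_id t _).smul_const (γ' 0))) hdiff h0 h1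
  have e : γ (-1) - γ 0 - -γ' 0 = (γ (-1) - (-1:ℝ) • γ' 0) - (γ 0 - (0:ℝ) • γ' 0) := by
    simp; abel
  rw [e]
  simpa using key

lemma grad_lin {K : ℕ} {ι : Type} (s s' : Finset ι) (h : ι → EE K → ℝ) (f : EE K → ℝ) (τ : ℝ)
    (hh : ∀ i, Differentiable ℝ (h i)) (hf : Differentiable ℝ f) :
    gradient (fun γ => (∑ i ∈ s, h i γ) + f γ + τ * ∑ i ∈ s', h i γ) =
      fun γ => (∑ i ∈ s, gradient (h i) γ) + gradient f γ + τ • ∑ i ∈ s', gradient (h i) γ := by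
  funext γ
  have h1 : HasFDerivAt (fun γ => (∑ i ∈ s, h i γ) + f γ + τ * ∑ i ∈ s', h i γ)
     ((∑ i ∈ s, fderiv ℝ (h i) γ) + fderiv ℝ f γ + τ • ∑ i ∈ s', fderiv ℝ (h i) γ) γ :=
    ((HasFDerivAt.fun_sum fun i _ => (hh i γ).hasFDerivAt).add (hf γ).hasFDerivAt).add
      ((HasFDerivAt.fun_sum fun i _ => (hh i γ).hasFDerivAt).const_mul τ)
  simp only [gradient, h1.fderiv, map_add, map_sum, map_smul]

/-- Group-removal version of Statement 5: for fixed `K ≥ 1`, `m ≥ 1`,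
`ĉ > 0`, `M, L, M₃ ≥ 0` there is a constant `C` (depending only on these data) such that for
every `n ≥ m + 1`, data set, and subset `S′` of the data of cardinality `m` (represented by a
set `s` of indices), under the stated convexity, minimization, and boundedness hypotheses,
with `γ_S = γ̂(0)` and `γ_{S−S′} = γ̂(−1)`,
`‖γ_{S−S′} − γ_S − (∇²F(γ_S))⁻¹ Σ_{z∈S′} ∇h(γ_S, z)‖ ≤ C/n²`. -/
theorem stmt_6 (K m : ℕ) (hK : 1 ≤ K) (hm : 1 ≤ m) (c M L M₃ : ℝ)
    (hc : 0 < c) (hM : 0 ≤ M) (hL : 0 ≤ L) (hM₃ : 0 ≤ M₃) :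
    ∃ C : ℝ, ∀ (Z : Type) (n : ℕ), m + 1 ≤ n →
      ∀ (z : Fin n → Z) (s : Finset (Fin n)), s.card = m →
      ∀ (h : EuclideanSpace ℝ (Fin K) → Z → ℝ) (f : EuclideanSpace ℝ (Fin K) → ℝ),
        ContDiff ℝ 3 f →
        (∀ i, ContDiff ℝ 3 (fun γ => h γ (z i))) →
        (∀ i, StrongConvexHess c (fun γ => h γ (z i))) →
        StrongConvexHess 0 f →
        ∀ γhat : ℝ → EuclideanSpace ℝ (Fin K),
        ContDiffOn ℝ 2 γhat (Icc (-1 : ℝ) 0) →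
        (∀ τ ∈ Icc (-1 : ℝ) 0, ∀ γ,
          (∑ i, h (γhat τ) (z i)) + f (γhat τ) + τ * ∑ i ∈ s, h (γhat τ) (z i)
            ≤ (∑ i, h γ (z i)) + f γ + τ * ∑ i ∈ s, h γ (z i)) →
        (∀ i ∈ s, ∀ τ ∈ Icc (-1 : ℝ) 0,
          ‖gradient (fun γ => h γ (z i)) (γhat τ)‖ ≤ M) →
        (∀ i ∈ s, ∀ τ ∈ Icc (-1 : ℝ) 0,
          ‖hessCLM (fun γ => h γ (z i)) (γhat τ)‖ ≤ L) →
        (∀ τ ∈ Icc (-1 : ℝ) 0, ∀ a b e : Fin K,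
          |iteratedFDeriv ℝ 3 f (γhat τ)
              ![EuclideanSpace.single a (1 : ℝ), EuclideanSpace.single b (1 : ℝ),
                EuclideanSpace.single e (1 : ℝ)]| ≤ M₃) →
        (∀ i, ∀ τ ∈ Icc (-1 : ℝ) 0, ∀ a b e : Fin K,
          |iteratedFDeriv ℝ 3 (fun γ => h γ (z i)) (γhat τ)
              ![EuclideanSpace.single a (1 : ℝ), EuclideanSpace.single b (1 : ℝ),
                EuclideanSpace.single e (1 : ℝ)]| ≤ M₃) →
        ‖γhat (-1) - γhat 0
            - (Ring.inverse (hessCLM (fun γ => (∑ i, h γ (z i)) + f γ) (γhat 0)))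
                (∑ i ∈ s, gradient (fun γ => h γ (z i)) (γhat 0))‖
          ≤ C / (n : ℝ) ^ 2 := by
  have hc' := hc.ne'
  set B : ℝ := m * M * (m + 1) / c with hB
  set T : ℝ := (K:ℝ)^3 * M₃ with hT
  have hB0 : 0 ≤ B := by positivity
  have hT0 : 0 ≤ T := by positivity
  refine ⟨(2 * T * B ^ 2 + 2 * (m * L) * B) * (m + 1) / c, ?_⟩
  intro Z n hn z s hs h f hf hh hsc hscf γ hγ hmin hMb hLb hf3 hh3
  have hn1 : 1 ≤ n := by omega
  have hnR : (1:ℝ) ≤ n := by exact_mod_cast hn1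
  have hnm : (m:ℝ) + 1 ≤ n := by exact_mod_cast hn
  have hnpos : (0:ℝ) < n := by linarith
  have hmR : (1:ℝ) ≤ m := by exact_mod_cast hm
  let g : Fin n → EE K → ℝ := fun i x => h x (z i)
  have hg : ∀ i, ContDiff ℝ 3 (g i) := hh
  have hgd : ∀ i, Differentiable ℝ (g i) := fun i => (hg i).differentiable (by norm_num)
  have hfd : Differentiable ℝ f := hf.differentiable (by norm_num)
  have hGd : ∀ i, Differentiable ℝ (gradient (g i)) := fun i =>
    (contDiff_grad (hg i)).differentiable (by norm_num)
  have hGf : Differentiable ℝ (gradient f) := (contDiff_grad hf).differentiable (by norm_num)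
  let Φ : EE K → EE K := fun x => (∑ i, gradient (g i) x) + gradient f x
  let Ψ : EE K → EE K := fun x => ∑ i ∈ s, gradient (g i) x
  have hΨ' : ∀ x, HasFDerivAt Ψ (∑ i ∈ s, hessCLM (g i) x) x := fun x =>
    HasFDerivAt.fun_sum fun i _ => (hGd i x).hasFDerivAt
  have hΦ' : ∀ x, HasFDerivAt Φ ((∑ i, hessCLM (g i) x) + hessCLM f x) x := fun x =>
    (HasFDerivAt.fun_sum fun i _ => (hGd i x).hasFDerivAt).add (hGf x).hasFDerivAt
  have hΦd : Differentiable ℝ Φ := fun x => (hΦ' x).differentiableAt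
  have hΨd : Differentiable ℝ Ψ := fun x => (hΨ' x).differentiableAt
  have hI0 : (0:ℝ) ∈ Icc (-1:ℝ) 0 := by simp
  have hγ' : ∀ t ∈ Icc (-1:ℝ) 0,
      HasDerivWithinAt γ (derivWithin γ (Icc (-1) 0) t) (Icc (-1) 0) t := fun t ht =>
    ((hγ.differentiableOn (by norm_num)) t ht).hasDerivWithinAt
  have hz : ∀ t ∈ Icc (-1:ℝ) 0, Φ (γ t) + t • Ψ (γ t) = 0 := by
    intro t ht
    have e := congrFun (grad_lin Finset.univ s g f t hgd hfd) (γ t)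
    have hl : IsLocalMin (fun x => (∑ i, g i x) + f x + t * ∑ i ∈ s, g i x) (γ t) :=
      Filter.Eventually.of_forall (hmin t ht)
    rw [gradient, hl.fderiv_eq_zero, map_zero] at e
    exact e.symm
  have hhess : hessCLM (fun x => (∑ i, h x (z i)) + f x) (γ 0) = fderiv ℝ Φ (γ 0) := by
    have e := grad_lin Finset.univ s g f 0 hgd hfd
    simp only [zero_mul, add_zero, zero_smul] at e
    exact congrArg (fun G : EE K → EE K => fderiv ℝ G (γ 0)) e
  -- coercivity
  set a : ℝ := c * n / (m + 1) with ha
  have ha0 : 0 < a := by positivity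
  have hacm : a ≤ c * (n - m) := by
    rw [ha, div_le_iff₀ (by positivity)]
    have : (n:ℝ) ≤ (n - m) * (m + 1) := by nlinarith
    nlinarith
  have hco : ∀ t ∈ Icc (-1:ℝ) 0, ∀ v,
      a * ‖v‖ ^ 2 ≤ ⟪(fderiv ℝ Φ (γ t) + t • fderiv ℝ Ψ (γ t)) v, v⟫ := by
    intro t ht v
    rw [(hΦ' _).fderiv, (hΨ' _).fderiv]
    simp only [add_apply, smul_apply, sum_apply, inner_add_left, sum_inner, real_inner_smul_left]
    have k0 : 0 ≤ ⟪hessCLM f (γ t) v, v⟫ := by simpa using hscf (γ t) v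
    have k1 : ∀ i, c * ‖v‖ ^ 2 ≤ ⟪hessCLM (g i) (γ t) v, v⟫ := fun i => hsc i (γ t) v
    have k2 : ∑ i, ⟪hessCLM (g i) (γ t) v, v⟫ = ∑ i ∈ s, ⟪hessCLM (g i) (γ t) v, v⟫
        + ∑ i ∈ sᶜ, ⟪hessCLM (g i) (γ t) v, v⟫ := (Finset.sum_add_sum_compl s _).symm
    have k3 : (n - m) * (c * ‖v‖ ^ 2) ≤ ∑ i ∈ sᶜ, ⟪hessCLM (g i) (γ t) v, v⟫ := by
      have := Finset.card_nsmul_le_sum sᶜ (fun i => ⟪hessCLM (g i) (γ t) v, v⟫) _ (fun i _ => k1 i)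
      rw [Finset.card_compl, hs, Fintype.card_fin, nsmul_eq_mul, Nat.cast_sub (by omega)] at this
      exact this
    have k4 : 0 ≤ ∑ i ∈ s, ⟪hessCLM (g i) (γ t) v, v⟫ :=
      Finset.sum_nonneg fun i _ => le_trans (by positivity) (k1 i)
    have k5 : 0 ≤ (1 + t) * ∑ i ∈ s, ⟪hessCLM (g i) (γ t) v, v⟫ :=
      mul_nonneg (by linarith [ht.1]) k4
    have k6 : a * ‖v‖ ^ 2 ≤ c * (n - m) * ‖v‖ ^ 2 := by gcongr
    rw [k2]
    linarith
  have hPsi : ∀ t ∈ Icc (-1:ℝ) 0, ‖Ψ (γ t)‖ ≤ m * M := by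
    intro t ht
    refine (norm_sum_le_of_le s fun i hi => hMb i hi t ht).trans ?_
    simp [hs]
  have hR : ∀ t ∈ Icc (-1:ℝ) 0, ‖derivWithin γ (Icc (-1) 0) t‖ ≤ B / n := by
    intro t ht
    have := coer_bound (P := m * M) ha0 _ (hco t ht) (derivWithin γ (Icc (-1) 0) t) (by
      rw [core_deriv Φ Ψ hΦd hΨd γ _ hγ' hz t ht, norm_neg]
      exact hPsi t ht)
    refine this.trans (le_of_eq ?_)
    rw [hB, ha]; field_simp
  have hQ : ∀ t ∈ Icc (-1:ℝ) 0, ‖fderiv ℝ Ψ (γ t)‖ ≤ m * L := by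
    intro t ht
    rw [(hΨ' _).fderiv]
    refine (norm_sum_le_of_le s fun i hi => hLb i hi t ht).trans ?_
    simp [hs]
  have hD : ∀ t ∈ Icc (-1:ℝ) 0, ‖fderiv ℝ Φ (γ 0) - fderiv ℝ Φ (γ t)‖ ≤ 2 * T * B := by
    intro t ht
    rw [(hΦ' _).fderiv, (hΦ' _).fderiv, add_sub_add_comm, ← Finset.sum_sub_distrib]
    have j1 := hess_curve hM₃ hf γ _ hγ' hR hf3 t ht
    have j2 : ∀ i ∈ Finset.univ, ‖hessCLM (g i) (γ 0) - hessCLM (g i) (γ t)‖ ≤ T * (B / n) :=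
      fun i _ => hess_curve hM₃ (hg i) γ _ hγ' hR (hh3 i) t ht
    have j3 := norm_sum_le_of_le _ j2
    rw [Finset.sum_const, Finset.card_univ, Fintype.card_fin, nsmul_eq_mul] at j3
    have j4 : (n:ℝ) * (T * (B / n)) = T * B := by field_simp
    have j5 : T * (B / n) ≤ T * B := by
      have : B / n ≤ B := div_le_self hB0 hnR
      gcongr
    refine (norm_add_le _ _).trans ?_
    linarith
  have hco0 : ∀ v, a * ‖v‖ ^ 2 ≤ ⟪fderiv ℝ Φ (γ 0) v, v⟫ := by
    simpa using hco 0 hI0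
  have fin := core ha0 (by positivity) (by positivity) (by positivity) Φ Ψ hΦd hΨd γ _ hγ' hz hco0 hR hQ hD
  rw [hhess]
  refine fin.trans (le_of_eq ?_)
  rw [ha]; field_simp
end
end

section
/- Let d ≥ 1, let μ¹, μ² ∈ ℝ^d and σ¹, σ² ∈ ℝ^d be such that 0 < M₁ ≤ σ^i_k ≤ M₂ for all i ∈ {1,2} and k ∈ {1,…,d}, and let q_i = ⊗_{k=1}^d N(μ^i_k, (σ^i_k)²) be the corresponding diagonal Gaussian measures on ℝ^d. Then KL(q₁ ‖ q₂) ≤ (1/(2M₁²)) · ( 2(M₁ + M₂) · Σ_{k=1}^d ( |μ¹_k − μ²_k| + |σ¹_k − σ²_k| ) + Σ_{k=1}^d ( (μ¹_k − μ²_k)² + (σ¹_k − σ²_k)² ) ). -/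
open MeasureTheory

noncomputable section

/-- The Kullback–Leibler divergence `KL(μ ‖ ν) = ∫ log (dμ/dν) dμ`. -/
def klDiv' {α : Type*} [MeasurableSpace α] (μ ν : Measure α) : ℝ :=
  ∫ x, Real.log (μ.rnDeriv ν x).toReal ∂μ

/-- The diagonal Gaussian measure `⊗ₖ N(μ k, (σ k)²)` on `ℝ^d`. -/
def diagGaussian {d : ℕ} (μ σ : Fin d → ℝ) : Measure (Fin d → ℝ) :=
  Measure.pi fun k => ProbabilityTheory.gaussianReal (μ k) (Real.toNNReal ((σ k) ^ 2))

open ProbabilityTheory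

lemma aux_pi_density {d : ℕ} (ν : Fin d → Measure ℝ) [∀ i, IsProbabilityMeasure (ν i)]
    (f : Fin d → ℝ → ENNReal) (hf : ∀ i, Measurable (f i))
    [∀ i, IsProbabilityMeasure ((ν i).withDensity (f i))] :
    Measure.pi (fun i => (ν i).withDensity (f i))
      = (Measure.pi ν).withDensity (fun x => ∏ i, f i (x i)) := by
  apply Measure.pi_eq
  intro s hs
  rw [withDensity_apply _ (MeasurableSet.univ_pi hs), ← lintegral_indicator (MeasurableSet.univ_pi hs)]
  have h1 : ∀ x : Fin d → ℝ, (Set.univ.pi s).indicator (fun x => ∏ i, f i (x i)) x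
      = ∏ i, (s i).indicator (f i) (x i) := by
    intro x
    by_cases hx : x ∈ Set.univ.pi s
    · rw [Set.indicator_of_mem hx]
      refine Finset.prod_congr rfl fun i _ => ?_
      rw [Set.indicator_of_mem (hx i (Set.mem_univ i))]
    · rw [Set.indicator_of_notMem hx]
      simp only [Set.mem_pi, Set.mem_univ, true_imp_iff, not_forall] at hx
      obtain ⟨i, hi⟩ := hx
      exact (Finset.prod_eq_zero (Finset.mem_univ i) (Set.indicator_of_notMem hi _)).symm
  simp_rw [h1]
  have hm : ∀ i, Measurable ((s i).indicator (f i)) := fun i => (hf i).indicator (hs i)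
  rw [lintegral_prod_eq_prod_lintegral_of_indepFun Finset.univ
    (fun i (x : Fin d → ℝ) => (s i).indicator (f i) (x i))
    (iIndepFun_pi (fun i => (hm i).aemeasurable))
    (fun i => (hm i).comp (measurable_pi_apply i))]
  refine Finset.prod_congr rfl fun i _ => ?_
  rw [withDensity_apply _ (hs i), ← lintegral_indicator (hs i)]
  exact (measurePreserving_eval ν i).lintegral_comp (hm i)

def auxQ (m₁ s₁ m₂ s₂ x : ℝ) : ℝ :=
  Real.log (s₂ / s₁) - (x - m₁) ^ 2 / (2 * s₁ ^ 2) + (x - m₂) ^ 2 / (2 * s₂ ^ 2)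

lemma auxQ_meas (m₁ s₁ m₂ s₂ : ℝ) : Measurable (auxQ m₁ s₁ m₂ s₂) := by
  unfold auxQ; fun_prop

lemma aux_density (m₁ s₁ m₂ s₂ : ℝ) (h₁ : 0 < s₁) (h₂ : 0 < s₂) :
    (gaussianReal m₂ (Real.toNNReal (s₂ ^ 2))).withDensity
        (fun x => ENNReal.ofReal (Real.exp (auxQ m₁ s₁ m₂ s₂ x)))
      = gaussianReal m₁ (Real.toNNReal (s₁ ^ 2)) := by
  have n₁ : Real.toNNReal (s₁ ^ 2) ≠ 0 := by
    have : 0 < s₁ ^ 2 := by positivity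
    simpa using this.ne'
  have n₂ : Real.toNNReal (s₂ ^ 2) ≠ 0 := by
    have : 0 < s₂ ^ 2 := by positivity
    simpa using this.ne'
  rw [gaussianReal_of_var_ne_zero _ n₁, gaussianReal_of_var_ne_zero _ n₂,
    ← withDensity_mul _ (g := fun x => ENNReal.ofReal (Real.exp (auxQ m₁ s₁ m₂ s₂ x)))
      (measurable_gaussianPDF _ _)
      (ENNReal.measurable_ofReal.comp (Real.measurable_exp.comp (auxQ_meas _ _ _ _)))]
  congr 1
  ext x
  simp only [Pi.mul_apply, gaussianPDF, gaussianPDFReal, Function.comp]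
  rw [← ENNReal.ofReal_mul (by positivity)]
  congr 1
  rw [Real.coe_toNNReal _ (sq_nonneg s₁), Real.coe_toNNReal _ (sq_nonneg s₂),
    Real.sqrt_mul (by positivity) (s₁ ^ 2), Real.sqrt_mul (by positivity) (s₂ ^ 2), Real.sqrt_sq h₁.le,
    Real.sqrt_sq h₂.le, mul_assoc, ← Real.exp_add]
  have : -(x - m₂) ^ 2 / (2 * s₂ ^ 2) + auxQ m₁ s₁ m₂ s₂ x
      = Real.log (s₂ / s₁) + -(x - m₁) ^ 2 / (2 * s₁ ^ 2) := by unfold auxQ; ring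
  rw [this, Real.exp_add, Real.exp_log (by positivity)]
  have : √(2 * Real.pi) ≠ 0 := by positivity
  field_simp

lemma aux_int (m : ℝ) (v : NNReal) (a : ℝ) :
    Integrable (fun x => (x - a) ^ 2) (gaussianReal m v) ∧
      ∫ x, (x - a) ^ 2 ∂(gaussianReal m v) = v + (m - a) ^ 2 := by
  have hL : MemLp id 2 (gaussianReal m v) := memLp_id_gaussianReal 2
  have i2 : Integrable (fun x : ℝ => x ^ 2) (gaussianReal m v) := hL.integrable_sq
  have i1 : Integrable (fun x : ℝ => x) (gaussianReal m v) := hL.integrable (by norm_num)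
  have hv := variance_eq_sub hL
  rw [variance_id_gaussianReal] at hv
  simp only [Pi.pow_apply, id_eq, integral_id_gaussianReal] at hv
  have e : (fun x : ℝ => (x - a) ^ 2) = fun x => x ^ 2 - (2 * a) * x + a ^ 2 := by
    ext x; ring
  have i3 := i2.sub (i1.const_mul (2 * a))
  refine ⟨?_, ?_⟩
  · rw [e]; exact i3.add (integrable_const _)
  · rw [e, integral_add (f := fun x : ℝ => x ^ 2 - (2 * a) * x) i3 (integrable_const _),
      integral_sub i2 (i1.const_mul (2 * a)), integral_const_mul, integral_id_gaussianReal]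
    simp
    linarith

lemma auxQ_int (m₁ s₁ m₂ s₂ : ℝ) (h₁ : 0 < s₁) :
    Integrable (auxQ m₁ s₁ m₂ s₂) (gaussianReal m₁ (Real.toNNReal (s₁ ^ 2))) ∧
      ∫ x, auxQ m₁ s₁ m₂ s₂ x ∂(gaussianReal m₁ (Real.toNNReal (s₁ ^ 2)))
        = Real.log (s₂ / s₁) - 1 / 2 + (s₁ ^ 2 + (m₁ - m₂) ^ 2) / (2 * s₂ ^ 2) := by
  obtain ⟨a1, b1⟩ := aux_int m₁ (Real.toNNReal (s₁ ^ 2)) m₁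
  obtain ⟨a2, b2⟩ := aux_int m₁ (Real.toNNReal (s₁ ^ 2)) m₂
  rw [Real.coe_toNNReal _ (sq_nonneg s₁)] at b1 b2
  have c1 := a1.div_const (2 * s₁ ^ 2)
  have c2 := a2.div_const (2 * s₂ ^ 2)
  have c0 : Integrable (fun _ : ℝ => Real.log (s₂ / s₁))
    (gaussianReal m₁ (Real.toNNReal (s₁ ^ 2))) := integrable_const _
  refine ⟨(c0.sub c1).add c2, ?_⟩
  unfold auxQ
  rw [integral_add (f := fun x : ℝ => Real.log (s₂ / s₁) - (x - m₁) ^ 2 / (2 * s₁ ^ 2))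
    (c0.sub c1) c2, integral_sub c0 c1, integral_div, integral_div, b1, b2]
  simp
  field_simp

lemma aux_bound (m₁ s₁ m₂ s₂ M₁ M₂ : ℝ) (hM : 0 < M₁) (h1 : M₁ ≤ s₁ ∧ s₁ ≤ M₂)
    (h2 : M₁ ≤ s₂ ∧ s₂ ≤ M₂) :
    Real.log (s₂ / s₁) - 1 / 2 + (s₁ ^ 2 + (m₁ - m₂) ^ 2) / (2 * s₂ ^ 2)
      ≤ (1 / (2 * M₁ ^ 2)) * (2 * (M₁ + M₂) * (|m₁ - m₂| + |s₁ - s₂|)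
            + ((m₁ - m₂) ^ 2 + (s₁ - s₂) ^ 2)) := by
  have p1 : 0 < s₁ := hM.trans_le h1.1
  have p2 : 0 < s₂ := hM.trans_le h2.1
  have l1 : Real.log (s₂ / s₁) ≤ |s₁ - s₂| / M₁ := by
    have := Real.log_le_sub_one_of_pos (div_pos p2 p1)
    have e : s₂ / s₁ - 1 = (s₂ - s₁) / s₁ := by field_simp
    calc _ ≤ (s₂ - s₁) / s₁ := by linarith
      _ ≤ |s₁ - s₂| / s₁ := by
        gcongr; rw [abs_sub_comm]; exact le_abs_self _
      _ ≤ _ := by gcongr; exact h1.1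
  have e2 : (s₁ ^ 2 + (m₁ - m₂) ^ 2) / (2 * s₂ ^ 2) - 1 / 2
      = (s₁ - s₂) / s₂ + ((m₁ - m₂) ^ 2 + (s₁ - s₂) ^ 2) / (2 * s₂ ^ 2) := by
    field_simp; ring
  have l2 : (s₁ - s₂) / s₂ ≤ |s₁ - s₂| / M₁ :=
    calc _ ≤ |s₁ - s₂| / s₂ := by gcongr; exact le_abs_self _
      _ ≤ _ := by gcongr; exact h2.1
  have l3 : ((m₁ - m₂) ^ 2 + (s₁ - s₂) ^ 2) / (2 * s₂ ^ 2)
      ≤ ((m₁ - m₂) ^ 2 + (s₁ - s₂) ^ 2) / (2 * M₁ ^ 2) := by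
    gcongr; exact h2.1
  have l4 : |s₁ - s₂| / M₁ + |s₁ - s₂| / M₁
      ≤ (1 / (2 * M₁ ^ 2)) * (2 * (M₁ + M₂) * (|m₁ - m₂| + |s₁ - s₂|)) := by
    have : |s₁ - s₂| / M₁ + |s₁ - s₂| / M₁
      = (1 / (2 * M₁ ^ 2)) * (2 * (M₁ + M₁) * (0 + |s₁ - s₂|)) := by field_simp; ring
    rw [this]
    gcongr
    · linarith [h1.1, h1.2]
    · linarith [h1.1, h1.2]
    · positivity
  have : (1 / (2 * M₁ ^ 2)) * (2 * (M₁ + M₂) * (|m₁ - m₂| + |s₁ - s₂|)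
            + ((m₁ - m₂) ^ 2 + (s₁ - s₂) ^ 2))
      = (1 / (2 * M₁ ^ 2)) * (2 * (M₁ + M₂) * (|m₁ - m₂| + |s₁ - s₂|))
        + ((m₁ - m₂) ^ 2 + (s₁ - s₂) ^ 2) / (2 * M₁ ^ 2) := by ring
  rw [this]
  linarith

/-- KL bound between two diagonal Gaussians with standard deviations in
`[M₁, M₂]`, `M₁ > 0`:
`KL(q₁‖q₂) ≤ (1/(2M₁²)) (2(M₁+M₂) Σₖ (|μ¹ₖ−μ²ₖ| + |σ¹ₖ−σ²ₖ|) + Σₖ ((μ¹ₖ−μ²ₖ)² + (σ¹ₖ−σ²ₖ)²))`. -/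
theorem stmt_7 {d : ℕ} (hd : 1 ≤ d) (μ₁ μ₂ σ₁ σ₂ : Fin d → ℝ) (M₁ M₂ : ℝ)
    (hM₁ : 0 < M₁)
    (hσ₁ : ∀ k, M₁ ≤ σ₁ k ∧ σ₁ k ≤ M₂)
    (hσ₂ : ∀ k, M₁ ≤ σ₂ k ∧ σ₂ k ≤ M₂) :
    klDiv' (diagGaussian μ₁ σ₁) (diagGaussian μ₂ σ₂)
      ≤ (1 / (2 * M₁ ^ 2)) *
          (2 * (M₁ + M₂) * (∑ k, (|μ₁ k - μ₂ k| + |σ₁ k - σ₂ k|))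
            + ∑ k, ((μ₁ k - μ₂ k) ^ 2 + (σ₁ k - σ₂ k) ^ 2)) := by
  have p1 : ∀ k, 0 < σ₁ k := fun k => hM₁.trans_le (hσ₁ k).1
  have p2 : ∀ k, 0 < σ₂ k := fun k => hM₁.trans_le (hσ₂ k).1
  set f : Fin d → ℝ → ENNReal := fun k x =>
    ENNReal.ofReal (Real.exp (auxQ (μ₁ k) (σ₁ k) (μ₂ k) (σ₂ k) x)) with hf
  have hfm : ∀ k, Measurable (f k) := fun k =>
    ENNReal.measurable_ofReal.comp (Real.measurable_exp.comp (auxQ_meas _ _ _ _))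
  have hd1 : ∀ k, (gaussianReal (μ₂ k) (Real.toNNReal ((σ₂ k) ^ 2))).withDensity (f k)
      = gaussianReal (μ₁ k) (Real.toNNReal ((σ₁ k) ^ 2)) := fun k =>
    aux_density _ _ _ _ (p1 k) (p2 k)
  have : ∀ k, IsProbabilityMeasure
      ((gaussianReal (μ₂ k) (Real.toNNReal ((σ₂ k) ^ 2))).withDensity (f k)) := fun k => by
    rw [hd1 k]; infer_instance
  have hpi : diagGaussian μ₁ σ₁
      = (diagGaussian μ₂ σ₂).withDensity (fun x => ∏ k, f k (x k)) := by
    have := aux_pi_density (fun k => gaussianReal (μ₂ k) (Real.toNNReal ((σ₂ k) ^ 2))) f hfm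
    simp only [hd1] at this
    exact this
  have : SigmaFinite (diagGaussian μ₂ σ₂) := by unfold diagGaussian; infer_instance
  have hFm : Measurable (fun x : Fin d → ℝ => ∏ k, f k (x k)) :=
    Finset.measurable_fun_prod _ fun k _ => (hfm k).comp (measurable_pi_apply k)
  have hae := Measure.rnDeriv_withDensity (diagGaussian μ₂ σ₂) hFm
  rw [← hpi] at hae
  have hac : diagGaussian μ₁ σ₁ ≪ diagGaussian μ₂ σ₂ := by
    rw [hpi]; exact withDensity_absolutelyContinuous _ _
  have hae' := hac.ae_le hae
  have hkl : klDiv' (diagGaussian μ₁ σ₁) (diagGaussian μ₂ σ₂)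
      = ∫ x, ∑ k, auxQ (μ₁ k) (σ₁ k) (μ₂ k) (σ₂ k) (x k) ∂(diagGaussian μ₁ σ₁) := by
    unfold klDiv'
    apply integral_congr_ae
    filter_upwards [hae'] with x hx
    rw [hx, ENNReal.toReal_prod]
    simp only [hf, ENNReal.toReal_ofReal (Real.exp_pos _).le]
    rw [← Real.exp_sum, Real.log_exp]
  rw [hkl]
  unfold diagGaussian
  rw [integral_finsetSum _ (fun k _ => integrable_comp_eval
    (μ := fun k => gaussianReal (μ₁ k) (Real.toNNReal ((σ₁ k) ^ 2)))
    (auxQ_int (μ₁ k) (σ₁ k) (μ₂ k) (σ₂ k) (p1 k)).1)]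
  rw [Finset.mul_sum, ← Finset.sum_add_distrib, Finset.mul_sum]
  refine Finset.sum_le_sum fun k _ => ?_
  rw [integral_comp_eval (μ := fun k => gaussianReal (μ₁ k) (Real.toNNReal ((σ₁ k) ^ 2)))
    (auxQ_meas _ _ _ _).aestronglyMeasurable,
    (auxQ_int (μ₁ k) (σ₁ k) (μ₂ k) (σ₂ k) (p1 k)).2]
  exact aux_bound _ _ _ _ _ _ hM₁ (hσ₁ k) (hσ₂ k)
end
end

section
/- Fix d ≥ 1, constants c > 0, M₁ > 0, and λ = (μ, σ) ∈ ℝ^d × (0,∞)^d with σ_k ≥ M₁ for every k. There exists a constant C′, depending only on d, c, M₁ and ‖λ‖, with the following property: for every n ≥ 1, every a ∈ ℝ, and every Δλ = (Δμ, Δσ) ∈ ℝ^{2d} with ‖Δλ‖ ≤ min(c/n, M₁/2), one has | sqrt( (C_{λ,Δλ} + a)/(4n − 2) ) − sqrt( (C_{λ,0} + a)/(4n − 2) ) | ≤ C′/n, where C_{λ,Δλ} = ‖Δλ‖² + 2·‖λ‖·‖Δλ‖ + ‖λ‖² − 2·Σ_{k=1}^d log(σ_k − Δσ_k) and C_{λ,0}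 = ‖λ‖² − 2·Σ_{k=1}^d log σ_k. (In other words, the forgetting update changes the PAC-Bayesian generalization bound by at most O(1/n).) -/
noncomputable section

/-- The Euclidean norm of the pair `(μ, σ) ∈ ℝ^{2d}`. -/
def pairNorm {d : ℕ} (μ σ : Fin d → ℝ) : ℝ :=
  Real.sqrt ((∑ k, (μ k) ^ 2) + ∑ k, (σ k) ^ 2)

theorem sqrt_sub_aux (x y : ℝ) : |Real.sqrt x - Real.sqrt y| ≤ Real.sqrt |x - y| := by
  have key : ∀ x y : ℝ, Real.sqrt x ≤ Real.sqrt y + Real.sqrt |x - y| := by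
    intro x y
    have hy := Real.sqrt_nonneg y
    have hz := Real.sqrt_nonneg |x - y|
    apply Real.sqrt_le_iff.2
    refine ⟨by positivity, ?_⟩
    have h1 := Real.sq_sqrt (abs_nonneg (x - y))
    have h2 : y ≤ Real.sqrt y ^ 2 := by
      rcases le_total 0 y with h | h
      · rw [Real.sq_sqrt h]
      · exact h.trans (sq_nonneg _)
    have h3 := le_abs_self (x - y)
    nlinarith [mul_nonneg hy hz]
  have h1 := key x y
  have h2 := key y x
  rw [abs_sub_comm y x] at h2
  rw [abs_le]
  constructor <;> linarith

theorem log_sub_aux (m x y : ℝ) (hm : 0 < m) (hx : m ≤ x) (hy : m ≤ y) :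
    |Real.log x - Real.log y| ≤ |x - y| / m := by
  have key : ∀ x y : ℝ, m ≤ x → m ≤ y → Real.log x - Real.log y ≤ |x - y| / m := by
    intro x y hx hy
    have hx0 : 0 < x := by linarith
    have hy0 : 0 < y := by linarith
    rw [← Real.log_div hx0.ne' hy0.ne']
    have h1 := Real.log_le_sub_one_of_pos (div_pos hx0 hy0)
    have h2 : x / y - 1 = (x - y) / y := by field_simp
    have h3 : (x - y) / y ≤ |x - y| / y := by gcongr; exact le_abs_self _
    have h4 : |x - y| / y ≤ |x - y| / m := by gcongr
    linarith
  have h1 := key x y hx hy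
  have h2 := key y x hy hx
  rw [abs_sub_comm y x] at h2
  rw [abs_le]
  constructor <;> linarith

theorem coord_aux {d : ℕ} (μ σ : Fin d → ℝ) (k : Fin d) : |σ k| ≤ pairNorm μ σ := by
  unfold pairNorm
  apply Real.abs_le_sqrt
  have h1 : 0 ≤ ∑ k, (μ k) ^ 2 := Finset.sum_nonneg fun _ _ => sq_nonneg _
  have h2 := Finset.single_le_sum (f := fun k => (σ k) ^ 2)
    (fun _ _ => sq_nonneg _) (Finset.mem_univ k)
  linarith

/-- For fixed `d ≥ 1`, `c > 0`, `M₁ > 0` and a fixed value `r` of `‖λ‖`,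
there is a constant `C′` (depending only on `d`, `c`, `M₁`, `r`) such that for every
`λ = (μ, σ)` with `‖λ‖ = r` and `σₖ ≥ M₁`, every `n ≥ 1`, every `a ∈ ℝ` and every
`Δλ = (Δμ, Δσ)` with `‖Δλ‖ ≤ min(c/n, M₁/2)`,
`|sqrt((C_{λ,Δλ} + a)/(4n−2)) − sqrt((C_{λ,0} + a)/(4n−2))| ≤ C′/n`, where
`C_{λ,Δλ} = ‖Δλ‖² + 2‖λ‖‖Δλ‖ + ‖λ‖² − 2 Σₖ log(σₖ − Δσₖ)` and
`C_{λ,0} = ‖λ‖² − 2 Σₖ log σₖ`. -/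
theorem stmt_13 (d : ℕ) (hd : 1 ≤ d) (c M₁ r : ℝ) (hc : 0 < c) (hM₁ : 0 < M₁)
    (hr : 0 ≤ r) :
    ∃ C' : ℝ, ∀ μ σ : Fin d → ℝ, pairNorm μ σ = r → (∀ k, M₁ ≤ σ k) →
      ∀ n : ℕ, 1 ≤ n → ∀ a : ℝ, ∀ Δμ Δσ : Fin d → ℝ,
        pairNorm Δμ Δσ ≤ min (c / (n : ℝ)) (M₁ / 2) →
        |Real.sqrt
            (((pairNorm Δμ Δσ) ^ 2 + 2 * pairNorm μ σ * pairNorm Δμ Δσ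
                + (pairNorm μ σ) ^ 2 - 2 * ∑ k, Real.log (σ k - Δσ k) + a)
              / (4 * (n : ℝ) - 2))
          - Real.sqrt
              (((pairNorm μ σ) ^ 2 - 2 * ∑ k, Real.log (σ k) + a)
                / (4 * (n : ℝ) - 2))|
          ≤ C' / (n : ℝ) := by
  refine ⟨Real.sqrt (c * (M₁ / 2 + 2 * r + 4 * d / M₁)), ?_⟩
  intro μ σ hl hσ n hn a Δμ Δσ hΔ
  have hco := coord_aux Δμ Δσ
  have ht0 : 0 ≤ pairNorm Δμ Δσ := Real.sqrt_nonneg _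
  rw [hl]
  generalize pairNorm Δμ Δσ = t at *
  have ht1 : t ≤ c / n := hΔ.trans (min_le_left _ _)
  have ht2 : t ≤ M₁ / 2 := hΔ.trans (min_le_right _ _)
  have hn1 : (1 : ℝ) ≤ n := by exact_mod_cast hn
  have hn0 : (0 : ℝ) < n := by linarith
  have hlog : ∀ k, |Real.log (σ k - Δσ k) - Real.log (σ k)| ≤ t / (M₁ / 2) := by
    intro k
    have h := abs_le.1 (hco k)
    have h' := hσ k
    refine (log_sub_aux (M₁ / 2) _ _ (by linarith) (by linarith) (by linarith)).trans ?_
    have : σ k - Δσ k - σ k = -Δσ k := by ring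
    rw [this, abs_neg]
    gcongr
    exact hco k
  have hsum : |∑ k, Real.log (σ k - Δσ k) - ∑ k, Real.log (σ k)| ≤ d * (t / (M₁ / 2)) := by
    rw [← Finset.sum_sub_distrib]
    refine (Finset.abs_sum_le_sum_abs _ _).trans ?_
    refine (Finset.sum_le_sum fun k _ => hlog k).trans ?_
    simp
  refine (sqrt_sub_aux _ _).trans ?_
  have hK : 0 ≤ M₁ / 2 + 2 * r + 4 * d / M₁ := by positivity
  have hn' : Real.sqrt (c * (M₁ / 2 + 2 * r + 4 * d / M₁)) / n
      = Real.sqrt (c * (M₁ / 2 + 2 * r + 4 * d / M₁) / (n : ℝ) ^ 2) := by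
    rw [Real.sqrt_div (by positivity), Real.sqrt_sq hn0.le]
  rw [hn']
  apply Real.sqrt_le_sqrt
  rw [← sub_div, abs_div, abs_of_pos (show (0 : ℝ) < 4 * n - 2 by linarith)]
  generalize ∑ k, Real.log (σ k - Δσ k) = A at *
  generalize ∑ k, Real.log (σ k) = B at *
  have hb : |t ^ 2 + 2 * r * t + r ^ 2 - 2 * A + a - (r ^ 2 - 2 * B + a)|
      ≤ t * (M₁ / 2 + 2 * r + 4 * d / M₁) := by
    have e : t * (M₁ / 2 + 2 * r + 4 * d / M₁)
        = t * (M₁ / 2) + 2 * r * t + 2 * (d * (t / (M₁ / 2))) := by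
      field_simp
      ring
    rw [e]
    have h := abs_le.1 hsum
    have h1 : t ^ 2 ≤ t * (M₁ / 2) := by nlinarith
    have h2 : 0 ≤ r * t := mul_nonneg hr ht0
    have h3 : 0 ≤ t ^ 2 := sq_nonneg t
    rw [abs_le]
    constructor <;> linarith [h.1, h.2]
  calc _ ≤ (c / n * (M₁ / 2 + 2 * r + 4 * d / M₁)) / n := by
        apply div_le_div₀ (by positivity) _ hn0 (by linarith)
        exact hb.trans (by gcongr)
    _ = _ := by field_simp
end
end

section
/- Let d ≥ 1 and n ≥ 1 be integers and δ ∈ (0,1). Then, with probability at least 1 − δ over an i.i.d. sample S = (z_1, …, z_n) drawn from D^{⊗n}, the following holds simultaneously for all θ₁, Δθ ∈ ℝ^d and all symmetric positive-definite d×d matrices J: writing Q for the multivariate Gaussian measure N(θ₁ − Δθ, (n·J)^{−1}) on ℝ^d, one has R(Q) ≤ R̂(Q, S) + sqrt( (C + 2·log(1/δ) + (d + 2)·log n − d + 4) / (4n − 2) ), where C = ‖Δθ‖² + 2·‖θ₁‖·‖Δθ‖ + ‖θ₁‖² + (1/n)·tr(J^{−1}) + log(det J). -/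
open MeasureTheory Matrix

noncomputable section

/-- Density of the multivariate Gaussian with mean `m` and covariance matrix `S` on `ℝ^d`. -/
def gaussianDensity {d : ℕ} (m : Fin d → ℝ) (S : Matrix (Fin d) (Fin d) ℝ)
    (x : Fin d → ℝ) : ℝ :=
  (Real.sqrt ((2 * Real.pi) ^ d * S.det))⁻¹ *
    Real.exp (-(1 / 2) * ((x - m) ⬝ᵥ (S⁻¹ *ᵥ (x - m))))

/-- The multivariate Gaussian measure `N(m, S)` on `ℝ^d`, defined by its density with respect
to Lebesgue measure. -/
def gaussianMeasure {d : ℕ} (m : Fin d → ℝ) (S : Matrix (Fin d) (Fin d) ℝ) :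
    Measure (Fin d → ℝ) :=
  volume.withDensity fun x => ENNReal.ofReal (gaussianDensity m S x)

/-- The Euclidean norm on `ℝ^d`. -/
def euclNorm {d : ℕ} (v : Fin d → ℝ) : ℝ :=
  Real.sqrt (∑ k, (v k) ^ 2)

/-- The expected risk `R(Q) = ∫∫ ℓ(θ, z) dD(z) dQ(θ)`. -/
def expRisk {d : ℕ} {Z : Type*} [MeasurableSpace Z] (D : Measure Z)
    (ℓ : (Fin d → ℝ) → Z → ℝ) (Q : Measure (Fin d → ℝ)) : ℝ :=
  ∫ θ, ∫ z, ℓ θ z ∂D ∂Q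

/-- The empirical risk `R̂(Q, S) = ∫ (1/n) Σᵢ ℓ(θ, zᵢ) dQ(θ)`. -/
def empRisk {d : ℕ} {Z : Type*} [MeasurableSpace Z]
    (ℓ : (Fin d → ℝ) → Z → ℝ) (Q : Measure (Fin d → ℝ)) {n : ℕ} (S : Fin n → Z) : ℝ :=
  ∫ θ, (1 / (n : ℝ)) * ∑ i, ℓ θ (S i) ∂Q

open ProbabilityTheory in
lemma aux_pi_gauss (d : ℕ) :
    (Measure.pi fun _ : Fin d => gaussianReal 0 1) = gaussianMeasure (0 : Fin d → ℝ) 1 := by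
  refine Measure.pi_eq fun s hs => ?_
  have hdens : ∀ x : Fin d → ℝ, gaussianDensity 0 1 x = ∏ i, gaussianPDFReal 0 1 (x i) := by
    intro x
    simp only [gaussianDensity, gaussianPDFReal, Finset.prod_mul_distrib, ← Real.exp_sum]
    congr 1
    · simp [Real.sqrt_eq_rpow, ← Real.rpow_natCast, ← Real.rpow_mul (mul_pos two_pos Real.pi_pos).le]
      rw [mul_comm (d : ℝ)]
    · congr 1
      simp only [dotProduct, Finset.mul_sum, sub_zero, inv_one, one_mulVec]
      exact Finset.sum_congr rfl fun i _ => by simp; ring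
  have hR : ∀ i, gaussianReal 0 1 (s i)
      = ENNReal.ofReal (∫ x, (s i).indicator (gaussianPDFReal 0 1) x) := by
    intro i
    rw [gaussianReal_apply_eq_integral _ one_ne_zero, integral_indicator (hs i)]
  simp_rw [hR]
  rw [← ENNReal.ofReal_prod_of_nonneg (fun i _ => integral_nonneg fun x =>
    Set.indicator_nonneg (fun _ _ => gaussianPDFReal_nonneg _ _ _) _),
    ← integral_fintype_prod_volume_eq_prod, ofReal_integral_eq_lintegral_ofReal, gaussianMeasure,
    withDensity_apply _ (MeasurableSet.univ_pi hs), ← lintegral_indicator (MeasurableSet.univ_pi hs)]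
  · refine lintegral_congr fun x => ?_
    by_cases hx : x ∈ Set.univ.pi s
    · rw [Set.indicator_of_mem hx, hdens]
      congr 1
      refine Finset.prod_congr rfl fun i _ => ?_
      rw [Set.indicator_of_mem (hx i trivial)]
    · rw [Set.indicator_of_notMem hx]
      simp only [Set.mem_pi, not_forall] at hx
      obtain ⟨i, _, hi⟩ := hx
      rw [Finset.prod_eq_zero (Finset.mem_univ i) (Set.indicator_of_notMem hi _)]
      simp
  · exact Integrable.fintype_prod fun i => (integrable_gaussianPDFReal 0 1).indicator (hs i)
  · exact ae_of_all _ fun x => Finset.prod_nonneg fun i _ =>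
      Set.indicator_nonneg (fun _ _ => gaussianPDFReal_nonneg _ _ _) _

lemma aux_meas_dens {d : ℕ} (m : Fin d → ℝ) (S : Matrix (Fin d) (Fin d) ℝ) :
    Measurable (gaussianDensity m S) := by
  unfold gaussianDensity
  simp only [dotProduct, mulVec]
  fun_prop

lemma aux_map {d : ℕ} (m : Fin d → ℝ) (B : Matrix (Fin d) (Fin d) ℝ) (hB : B.det ≠ 0) :
    Measure.map (fun y => B *ᵥ y + m) (gaussianMeasure (0 : Fin d → ℝ) 1)
      = gaussianMeasure m (B * Bᵀ) := by
  have hT : Measurable (fun y : Fin d → ℝ => B *ᵥ y + m) := by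
    exact (Continuous.add ((toLin' B).continuous_of_finiteDimensional) continuous_const).measurable
  have hvol : Measure.map (fun y : Fin d → ℝ => B *ᵥ y + m) volume
      = ENNReal.ofReal |B.det⁻¹| • (volume : Measure (Fin d → ℝ)) := by
    have h1 := Real.map_matrix_volume_pi_eq_smul_volume_pi hB
    have h2 : (fun y : Fin d → ℝ => B *ᵥ y + m) = (fun z => z + m) ∘ (toLin' B) := by
      ext y; simp
    rw [h2, ← Measure.map_map (by fun_prop) (by exact (LinearMap.continuous_of_finiteDimensional _).measurable), h1,
      Measure.map_smul, map_add_right_eq_self]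
  have hdens : ∀ y, gaussianDensity 0 1 y = |B.det| * gaussianDensity m (B * Bᵀ) (B *ᵥ y + m) := by
    intro y
    have hu : IsUnit B.det := isUnit_iff_ne_zero.2 hB
    have hq : (B *ᵥ y) ⬝ᵥ ((B * Bᵀ)⁻¹ *ᵥ (B *ᵥ y)) = y ⬝ᵥ y := by
      have : (B * Bᵀ)⁻¹ * B = (Bᵀ)⁻¹ := by
        rw [Matrix.mul_inv_rev, Matrix.mul_assoc, Matrix.nonsing_inv_mul _ hu, Matrix.mul_one]
      rw [mulVec_mulVec, this, dotProduct_comm, dotProduct_mulVec, ← mulVec_transpose, mulVec_mulVec,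
        Matrix.mul_nonsing_inv _ (by simpa using hu), one_mulVec]
    simp only [gaussianDensity, add_sub_cancel_right, hq, det_one, mul_one, sub_zero, inv_one, one_mulVec, det_mul, det_transpose]
    rw [Real.sqrt_mul (by positivity), Real.sqrt_mul_self_eq_abs]
    have := abs_pos.2 hB
    field_simp
  ext s hs
  rw [Measure.map_apply hT hs, gaussianMeasure, gaussianMeasure, withDensity_apply _ (hT hs),
    withDensity_apply _ hs]
  have h3 : (volume : Measure (Fin d → ℝ))
      = ENNReal.ofReal |B.det| • Measure.map (fun y : Fin d → ℝ => B *ᵥ y + m) volume := by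
    rw [hvol, smul_smul, ← ENNReal.ofReal_mul (abs_nonneg _), ← abs_mul, mul_inv_cancel₀ hB]
    simp
  conv_rhs => rw [h3]
  rw [Measure.restrict_smul, lintegral_smul_measure,
    setLIntegral_map hs (aux_meas_dens _ _).ennreal_ofReal hT, smul_eq_mul, ← lintegral_const_mul]
  · refine lintegral_congr fun y => ?_
    rw [hdens, ENNReal.ofReal_mul (abs_nonneg _)]
  · exact (aux_meas_dens _ _).ennreal_ofReal.comp hT

open scoped MatrixOrder in
lemma aux_sqrt {d : ℕ} {S : Matrix (Fin d) (Fin d) ℝ} (hS : S.PosDef) :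
    ∃ B : Matrix (Fin d) (Fin d) ℝ, B.det ≠ 0 ∧ S = B * Bᵀ := by
  obtain ⟨B, hB⟩ := CStarAlgebra.nonneg_iff_eq_star_mul_self.mp hS.posSemidef.nonneg
  have hB' : S = Bᵀ * B := by rw [hB, star_eq_conjTranspose, conjTranspose_eq_transpose_of_trivial]
  refine ⟨Bᵀ, ?_, by simpa using hB'⟩
  intro h
  have := hS.det_pos
  rw [hB', det_mul, h] at this
  simp at this

lemma aux_prob {d : ℕ} (m : Fin d → ℝ) {S : Matrix (Fin d) (Fin d) ℝ} (hS : S.PosDef) :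
    IsProbabilityMeasure (gaussianMeasure m S) := by
  obtain ⟨B, hB, rfl⟩ := aux_sqrt hS
  rw [← aux_map m B hB, ← aux_pi_gauss]
  refine Measure.isProbabilityMeasure_map (Measurable.aemeasurable ?_)
  exact (Continuous.add ((toLin' B).continuous_of_finiteDimensional) continuous_const).measurable

open ProbabilityTheory in
lemma aux_moment {d : ℕ} (b : Fin d → ℝ) (c : ℝ) :
    Integrable (fun y : Fin d → ℝ => (∑ k, b k * y k + c) ^ 2)
      (Measure.pi fun _ : Fin d => gaussianReal 0 1) ∧
    ∫ y, (∑ k, b k * y k + c) ^ 2 ∂(Measure.pi fun _ : Fin d => gaussianReal 0 1)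
      = ∑ k, b k ^ 2 + c ^ 2 := by
  have hid : MemLp (fun x : ℝ => x) 2 (gaussianReal 0 1) := memLp_id_gaussianReal' 2 (by simp)
  have hm : ∀ k, MemLp (fun y : Fin d → ℝ => b k * y k) 2
      (Measure.pi fun _ : Fin d => gaussianReal 0 1) := fun k =>
    (hid.const_mul (b k)).comp_measurePreserving (measurePreserving_eval _ k)
  have hs : MemLp (fun y : Fin d → ℝ => ∑ k, b k * y k) 2
      (Measure.pi fun _ : Fin d => gaussianReal 0 1) := memLp_finsetSum _ fun k _ => hm k
  have hX : MemLp (fun y : Fin d → ℝ => ∑ k, b k * y k + c) 2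
      (Measure.pi fun _ : Fin d => gaussianReal 0 1) := hs.add (memLp_const c)
  refine ⟨hX.integrable_sq, ?_⟩
  have h1 := variance_eq_sub hX
  have hE0 : ∀ k, ∫ y, b k * y k ∂(Measure.pi fun _ : Fin d => gaussianReal 0 1) = 0 := by
    intro k
    rw [integral_const_mul, integral_comp_eval (μ := fun _ : Fin d => gaussianReal 0 1) (i := k) (f := fun x : ℝ => x) hid.aestronglyMeasurable,
      integral_id_gaussianReal, mul_zero]
  have hE : ∫ y, (∑ k, b k * y k + c) ∂(Measure.pi fun _ : Fin d => gaussianReal 0 1) = c := by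
    rw [integral_add (hs.integrable (by simp)) (integrable_const c),
      integral_finsetSum _ fun k _ => (hm k).integrable (by simp)]
    simp [hE0]
  have hV : Var[fun y : Fin d → ℝ => ∑ k, b k * y k + c; Measure.pi fun _ : Fin d => gaussianReal 0 1]
      = ∑ k, b k ^ 2 := by
    rw [variance_add_const hs.aestronglyMeasurable]
    have := variance_sum_pi (μ := fun _ : Fin d => gaussianReal 0 1)
      (X := fun k x => b k * x) (fun k => hid.const_mul (b k))
    have h2 : (∑ k, fun y : Fin d → ℝ => b k * y k) = fun y : Fin d → ℝ => ∑ k, b k * y k := by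
      ext y; simp
    rw [h2] at this
    rw [this]
    refine Finset.sum_congr rfl fun k _ => ?_
    have h3 : Var[fun x : ℝ => x; gaussianReal 0 1] = 1 := by
      have := @variance_id_gaussianReal 0 1
      simp
    rw [variance_const_mul, h3, mul_one]
  rw [hV, hE] at h1
  have h4 : ∫ y, (∑ k, b k * y k + c) ^ 2 ∂(Measure.pi fun _ : Fin d => gaussianReal 0 1)
    = ∫ y, ((fun y : Fin d → ℝ => ∑ k, b k * y k + c) ^ 2) y ∂(Measure.pi fun _ : Fin d => gaussianReal 0 1) := rfl
  rw [h4]; linarith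

/-- log of the density ratio between `N(m,S)` and `N(0,1)` -/
def auxG {d : ℕ} (m : Fin d → ℝ) (S : Matrix (Fin d) (Fin d) ℝ) (x : Fin d → ℝ) : ℝ :=
  -(1 / 2) * Real.log S.det - (1 / 2) * ((x - m) ⬝ᵥ (S⁻¹ *ᵥ (x - m))) + (1 / 2) * (x ⬝ᵥ x)

lemma aux_meas_G {d : ℕ} (m : Fin d → ℝ) (S : Matrix (Fin d) (Fin d) ℝ) :
    Measurable (auxG m S) := by
  unfold auxG
  simp only [dotProduct, mulVec]
  fun_prop

lemma aux_dens_G {d : ℕ} (m : Fin d → ℝ) {S : Matrix (Fin d) (Fin d) ℝ} (hS : S.PosDef)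
    (x : Fin d → ℝ) :
    gaussianDensity m S x = gaussianDensity 0 1 x * Real.exp (auxG m S x) := by
  have hd := hS.det_pos
  have h1 : Real.exp (-(1 / 2) * Real.log S.det) = (Real.sqrt S.det)⁻¹ := by
    rw [Real.sqrt_eq_rpow, ← Real.rpow_neg hd.le, Real.rpow_def_of_pos hd]
    congr 1; ring
  rw [auxG, Real.exp_add, sub_eq_add_neg, Real.exp_add, h1, gaussianDensity, gaussianDensity,
    Real.sqrt_mul (by positivity), mul_inv]
  simp only [det_one, mul_one, sub_zero, inv_one, one_mulVec]
  have h2 : Real.exp (-(1 / 2) * (x ⬝ᵥ x)) * Real.exp ((1 / 2) * (x ⬝ᵥ x)) = 1 := by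
    rw [← Real.exp_add]; simp
  have h3 : -(1 / 2) * ((x - m) ⬝ᵥ S⁻¹ *ᵥ (x - m)) = -((1 / 2) * ((x - m) ⬝ᵥ S⁻¹ *ᵥ (x - m))) := by ring
  rw [h3]
  linear_combination (-(√((2 * Real.pi) ^ d))⁻¹ * (√S.det)⁻¹ * Real.exp (-((1 / 2) * ((x - m) ⬝ᵥ S⁻¹ *ᵥ (x - m))))) * h2

open ProbabilityTheory in
lemma aux_int_G {d : ℕ} (m : Fin d → ℝ) {S : Matrix (Fin d) (Fin d) ℝ} (hS : S.PosDef) :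
    Integrable (auxG m S) (gaussianMeasure m S) ∧
    ∫ x, auxG m S x ∂(gaussianMeasure m S)
      = (1 / 2) * (∑ k, m k ^ 2 + S.trace - d - Real.log S.det) := by
  have hG := aux_meas_G m S
  obtain ⟨B, hB, rfl⟩ := aux_sqrt hS
  have hT : Measurable (fun y : Fin d → ℝ => B *ᵥ y + m) :=
    (Continuous.add ((toLin' B).continuous_of_finiteDimensional) continuous_const).measurable
  have hq : ∀ y, (B *ᵥ y) ⬝ᵥ ((B * Bᵀ)⁻¹ *ᵥ (B *ᵥ y)) = y ⬝ᵥ y := by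
    intro y
    have hu : IsUnit B.det := isUnit_iff_ne_zero.2 hB
    have : (B * Bᵀ)⁻¹ * B = (Bᵀ)⁻¹ := by
      rw [Matrix.mul_inv_rev, Matrix.mul_assoc, Matrix.nonsing_inv_mul _ hu, Matrix.mul_one]
    rw [mulVec_mulVec, this, dotProduct_comm, dotProduct_mulVec, ← mulVec_transpose, mulVec_mulVec,
      Matrix.mul_nonsing_inv _ (by simpa using hu), one_mulVec]
  have hcomp : ∀ y, auxG m (B * Bᵀ) (B *ᵥ y + m) =
      -(1 / 2) * Real.log (B * Bᵀ).det
        - (1 / 2) * (∑ i, (∑ k, (Pi.single i (1 : ℝ) : Fin d → ℝ) k * y k + 0) ^ 2)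
        + (1 / 2) * ∑ i, (∑ k, B i k * y k + m i) ^ 2 := by
    intro y
    simp only [auxG, add_sub_cancel_right, hq]
    congr 1
    · congr 2
      simp [dotProduct, sq, Pi.single_apply]
    · congr 1
      simp [dotProduct, sq, mulVec]
  rw [← aux_map m B hB, ← aux_pi_gauss, integrable_map_measure hG.aestronglyMeasurable hT.aemeasurable,
    integral_map hT.aemeasurable hG.aestronglyMeasurable]
  have e : auxG m (B * Bᵀ) ∘ (fun y : Fin d → ℝ => B *ᵥ y + m) = fun y =>
      -(1 / 2) * Real.log (B * Bᵀ).det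
        - (1 / 2) * (∑ i, (∑ k, (Pi.single i (1 : ℝ) : Fin d → ℝ) k * y k + 0) ^ 2)
        + (1 / 2) * ∑ i, (∑ k, B i k * y k + m i) ^ 2 := funext hcomp
  rw [e]
  simp only [hcomp]
  have i1 := integrable_finsetSum (Finset.univ : Finset (Fin d)) fun i _ => (aux_moment (Pi.single i (1 : ℝ) : Fin d → ℝ) 0).1
  have i2 := integrable_finsetSum (Finset.univ : Finset (Fin d)) fun i _ => (aux_moment (fun k => B i k) (m i)).1
  have i0 := (integrable_const (μ := Measure.pi fun _ : Fin d => gaussianReal 0 1)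
    (-(1 / 2) * Real.log (B * Bᵀ).det)).sub (i1.const_mul (1 / 2))
  refine ⟨i0.add (i2.const_mul _), ?_⟩
  have e1 := integral_add i0 (i2.const_mul (1 / 2))
  simp only [Pi.sub_apply] at e1
  rw [e1, integral_sub (integrable_const _) (i1.const_mul (1 / 2)), integral_const_mul (1 / 2 : ℝ), integral_const_mul (1 / 2 : ℝ),
    integral_finsetSum _ fun i _ => (aux_moment (Pi.single i (1 : ℝ) : Fin d → ℝ) 0).1,
    integral_finsetSum _ fun i _ => (aux_moment (fun k => B i k) (m i)).1]
  simp only [(aux_moment (Pi.single _ (1 : ℝ) : Fin d → ℝ) 0).2,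
    (aux_moment (fun k => B _ k) (m _)).2, Finset.sum_add_distrib]
  have ht : (B * Bᵀ).trace = ∑ i, ∑ k, B i k ^ 2 := by
    simp [Matrix.trace, Matrix.mul_apply, sq]
  have h1 : ∑ i : Fin d, ∑ k, (Pi.single i (1 : ℝ) : Fin d → ℝ) k ^ 2 = d := by
    simp [Pi.single_apply]
  rw [ht, h1]
  simp
  ring

lemma aux_change {d : ℕ} (m : Fin d → ℝ) {S : Matrix (Fin d) (Fin d) ℝ} (hS : S.PosDef)
    (f : (Fin d → ℝ) → ℝ) (hf : Measurable f) (hfi : Integrable f (gaussianMeasure m S))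
    (K : ℝ) (hK : 0 < K)
    (hb : ∫⁻ x, ENNReal.ofReal (Real.exp (f x)) ∂(gaussianMeasure (0 : Fin d → ℝ) 1)
      ≤ ENNReal.ofReal K) :
    ∫ x, f x ∂(gaussianMeasure m S)
      ≤ (1 / 2) * (∑ k, m k ^ 2 + S.trace - d - Real.log S.det) + Real.log K := by
  have := aux_prob m hS
  obtain ⟨hgi, hge⟩ := aux_int_G m hS
  have hG := aux_meas_G m S
  have hE : Measurable fun x => Real.exp (f x - auxG m S x) := (hf.sub hG).exp
  have h1 : ∫⁻ x, ENNReal.ofReal (Real.exp (f x - auxG m S x)) ∂(gaussianMeasure m S)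
      = ∫⁻ x, ENNReal.ofReal (Real.exp (f x)) ∂(gaussianMeasure (0 : Fin d → ℝ) 1) := by
    rw [gaussianMeasure, gaussianMeasure,
      lintegral_withDensity_eq_lintegral_mul _ (aux_meas_dens _ _).ennreal_ofReal hE.ennreal_ofReal,
      lintegral_withDensity_eq_lintegral_mul _ (aux_meas_dens _ _).ennreal_ofReal hf.exp.ennreal_ofReal]
    refine lintegral_congr fun x => ?_
    simp only [Pi.mul_apply]
    rw [← ENNReal.ofReal_mul' (Real.exp_pos _).le, ← ENNReal.ofReal_mul' (Real.exp_pos _).le,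
      aux_dens_G m hS, mul_assoc, ← Real.exp_add]
    congr 3
    ring_nf
  rw [← h1] at hb
  have hEi : Integrable (fun x => Real.exp (f x - auxG m S x)) (gaussianMeasure m S) := by
    refine ⟨hE.aestronglyMeasurable, ?_⟩
    rw [hasFiniteIntegral_iff_ofReal (ae_of_all _ fun x => (Real.exp_pos _).le)]
    exact hb.trans_lt ENNReal.ofReal_lt_top
  rw [← ofReal_integral_eq_lintegral_ofReal hEi (ae_of_all _ fun x => (Real.exp_pos _).le),
    ENNReal.ofReal_le_ofReal_iff hK.le] at hb
  have hJ : Real.exp (∫ x, (f x - auxG m S x) ∂(gaussianMeasure m S))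
      ≤ ∫ x, Real.exp (f x - auxG m S x) ∂(gaussianMeasure m S) :=
    convexOn_exp.map_integral_le Real.continuous_exp.continuousOn isClosed_univ
      (by simp) (hfi.sub hgi) hEi
  rw [integral_sub hfi hgi, hge] at hJ
  have := (Real.le_log_iff_exp_le hK).2 (hJ.trans hb)
  linarith

lemma aux_lgauss {b : ℝ} (hb : 0 < b) :
    ∫⁻ t : ℝ, ENNReal.ofReal (Real.exp (-b * t ^ 2)) = ENNReal.ofReal (√(Real.pi / b)) := by
  rw [← ofReal_integral_eq_lintegral_ofReal (integrable_exp_neg_mul_sq hb)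
    (ae_of_all _ fun x => (Real.exp_pos _).le), integral_gaussian]

lemma aux_lin (a : ℝ) :
    ENNReal.ofReal (√Real.pi) * ENNReal.ofReal (Real.exp (a ^ 2))
      = ∫⁻ t : ℝ, ENNReal.ofReal (Real.exp (-t ^ 2)) * ENNReal.ofReal (Real.exp (2 * t * a)) := by
  have h := aux_lgauss one_pos
  rw [div_one, ← lintegral_sub_right_eq_self _ a] at h
  rw [← h, ← lintegral_mul_const _ (by fun_prop)]
  refine lintegral_congr fun t => ?_
  rw [← ENNReal.ofReal_mul (Real.exp_pos _).le, ← ENNReal.ofReal_mul (Real.exp_pos _).le,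
    ← Real.exp_add, ← Real.exp_add]
  congr 2
  ring

open ProbabilityTheory in
lemma aux_mgf {n : ℕ} {Z : Type*} [MeasurableSpace Z] (D : Measure Z)
    [IsProbabilityMeasure D] (h : Z → ℝ) (hm : Measurable h) (hb : ∀ z, h z ∈ Set.Icc (0 : ℝ) 1)
    (s : ℝ) :
    ∫⁻ S : Fin n → Z, ENNReal.ofReal (Real.exp (s * ∑ i, (h (S i) - ∫ z, h z ∂D)))
      ∂(Measure.pi fun _ : Fin n => D) ≤ ENNReal.ofReal (Real.exp (n * s ^ 2 / 8)) := by
  have hi : iIndepFun (fun (i : Fin n) (S : Fin n → Z) => h (S i) - ∫ z, h z ∂D)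
      (Measure.pi fun _ : Fin n => D) :=
    iIndepFun_pi (μ := fun _ : Fin n => D) (X := fun _ z => h z - ∫ z, h z ∂D)
      fun i => (hm.sub_const _).aemeasurable
  have hsub : ∀ i ∈ (Finset.univ : Finset (Fin n)),
      HasSubgaussianMGF (fun (S : Fin n → Z) => h (S i) - ∫ z, h z ∂D) ((‖(1 : ℝ) - 0‖₊ / 2) ^ 2)
      (Measure.pi fun _ : Fin n => D) := by
    intro i _
    have := hasSubgaussianMGF_of_mem_Icc (μ := Measure.pi fun _ : Fin n => D)
      (X := fun S => h (S i)) (a := 0) (b := 1) (hm.comp (measurable_pi_apply i)).aemeasurable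
      (ae_of_all _ fun S => hb _)
    rwa [integral_comp_eval (μ := fun _ : Fin n => D) (i := i) hm.aestronglyMeasurable] at this
  have hS := HasSubgaussianMGF.sum_of_iIndepFun hi hsub
  rw [← ofReal_integral_eq_lintegral_ofReal (hS.integrable_exp_mul s)
    (ae_of_all _ fun x => (Real.exp_pos _).le)]
  apply ENNReal.ofReal_le_ofReal
  refine (hS.mgf_le s).trans_eq ?_
  congr 1
  simp
  ring

lemma aux_exp {n : ℕ} (hn : 1 ≤ n) {Z : Type*} [MeasurableSpace Z] (D : Measure Z)
    [IsProbabilityMeasure D] (h : Z → ℝ) (hm : Measurable h)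
    (hb : ∀ z, h z ∈ Set.Icc (0 : ℝ) 1) :
    ∫⁻ S : Fin n → Z, ENNReal.ofReal (Real.exp ((2 * n - 1) *
        (∫ z, h z ∂D - (1 / (n : ℝ)) * ∑ i, h (S i)) ^ 2))
      ∂(Measure.pi fun _ : Fin n => D) ≤ ENNReal.ofReal (√(2 * n)) := by
  have hn' : (1 : ℝ) ≤ n := by exact_mod_cast hn
  have hn0 : (0 : ℝ) < n := by linarith
  set c := ∫ z, h z ∂D with hc
  set l := √(2 * (n : ℝ) - 1) with hl
  have hl2 : l ^ 2 = 2 * n - 1 := Real.sq_sqrt (by linarith)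
  have hpi : ENNReal.ofReal (√Real.pi) ≠ 0 := by
    simp [Real.sqrt_pos.2 Real.pi_pos]
  have hsq : ∀ S : Fin n → Z, (2 * n - 1) * (c - (1 / (n : ℝ)) * ∑ i, h (S i)) ^ 2
      = (l / n * ∑ i, (h (S i) - c)) ^ 2 := by
    intro S
    rw [← hl2, Finset.sum_sub_distrib]
    simp
    field_simp
    ring
  simp_rw [hsq]
  rw [← ENNReal.mul_le_mul_iff_right hpi ENNReal.ofReal_ne_top, ← lintegral_const_mul _ (by fun_prop)]
  simp_rw [aux_lin]
  rw [lintegral_lintegral_swap (by fun_prop)]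
  calc _ ≤ ∫⁻ t : ℝ, ENNReal.ofReal (Real.exp (-(1 / (2 * n)) * t ^ 2)) := by
        refine lintegral_mono fun t => ?_
        rw [lintegral_const_mul _ (by fun_prop)]
        have := aux_mgf (n := n) D h hm hb (2 * t * (l / n))
        have e : ∀ S : Fin n → Z, 2 * t * (l / n * ∑ i, (h (S i) - c))
            = 2 * t * (l / n) * ∑ i, (h (S i) - c) := fun S => by ring
        simp_rw [e]
        refine (mul_le_mul_right this _).trans_eq ?_
        rw [← ENNReal.ofReal_mul (Real.exp_pos _).le, ← Real.exp_add]
        congr 2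
        have : (2 * t * (l / n)) ^ 2 = 4 * t ^ 2 * (2 * n - 1) / n ^ 2 := by
          rw [← hl2]; ring
        rw [this]
        field_simp
        ring
    _ = _ := by
        rw [aux_lgauss (by positivity), ← ENNReal.ofReal_mul (by positivity), ← Real.sqrt_mul Real.pi_pos.le]
        congr 2
        field_simp

/-- PAC-Bayesian generalization bound for processed asymptotic MCMC
posteriors: with probability at least `1 − δ` over an i.i.d. sample `S ~ D^⊗n`,
simultaneously for all `θ₁, Δθ ∈ ℝ^d` and symmetric positive-definite `J`, writing
`Q = N(θ₁ − Δθ, (nJ)⁻¹)`,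
`R(Q) ≤ R̂(Q, S) + sqrt((C + 2 log(1/δ) + (d+2) log n − d + 4)/(4n − 2))`, where
`C = ‖Δθ‖² + 2‖θ₁‖‖Δθ‖ + ‖θ₁‖² + (1/n) tr(J⁻¹) + log det J`. -/
theorem stmt_14 (d n : ℕ) (hd : 1 ≤ d) (hn : 1 ≤ n) (δ : ℝ) (hδ : δ ∈ Set.Ioo (0 : ℝ) 1)
    {Z : Type*} [MeasurableSpace Z] (D : Measure Z) [IsProbabilityMeasure D]
    (ℓ : (Fin d → ℝ) → Z → ℝ) (hmeas : Measurable (Function.uncurry ℓ))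
    (hℓ : ∀ θ z, ℓ θ z ∈ Set.Icc (0 : ℝ) 1) :
    1 - ENNReal.ofReal δ ≤
      (Measure.pi fun _ : Fin n => D)
        {S : Fin n → Z |
          ∀ (θ₁ Δθ : Fin d → ℝ) (J : Matrix (Fin d) (Fin d) ℝ), J.PosDef →
            expRisk D ℓ (gaussianMeasure (θ₁ - Δθ) ((n : ℝ) • J)⁻¹)
              ≤ empRisk ℓ (gaussianMeasure (θ₁ - Δθ) ((n : ℝ) • J)⁻¹) S
                + Real.sqrt
                    (((euclNorm Δθ) ^ 2 + 2 * euclNorm θ₁ * euclNorm Δθ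
                        + (euclNorm θ₁) ^ 2 + (1 / (n : ℝ)) * (J⁻¹).trace
                        + Real.log J.det
                        + 2 * Real.log (1 / δ) + ((d : ℝ) + 2) * Real.log (n : ℝ)
                        - (d : ℝ) + 4)
                      / (4 * (n : ℝ) - 2))} := by
  have hn' : (1 : ℝ) ≤ n := by exact_mod_cast hn
  have hn0 : (0 : ℝ) < n := by linarith
  obtain ⟨hδ0, hδ1⟩ := hδ
  have hone : (1 : Matrix (Fin d) (Fin d) ℝ).PosDef := Matrix.PosDef.one
  have hP := aux_prob (0 : Fin d → ℝ) hone
  have hr : Measurable fun θ => ∫ z, ℓ θ z ∂D :=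
    (hmeas.stronglyMeasurable.integral_prod_right (ν := D)).measurable
  have hl : ∀ i : Fin n, Measurable fun p : (Fin n → Z) × (Fin d → ℝ) => ℓ p.2 (p.1 i) := fun i =>
    hmeas.comp (measurable_snd.prodMk ((measurable_pi_apply i).comp measurable_fst))
  have hΔ : Measurable fun p : (Fin n → Z) × (Fin d → ℝ) =>
      ∫ z, ℓ p.2 z ∂D - (1 / (n : ℝ)) * ∑ i, ℓ p.2 (p.1 i) :=
    (hr.comp measurable_snd).sub ((Finset.measurable_sum _ fun i _ => hl i).const_mul _)
  have hE : Measurable fun p : (Fin n → Z) × (Fin d → ℝ) => ENNReal.ofReal (Real.exp ((2 * n - 1) *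
      (∫ z, ℓ p.2 z ∂D - (1 / (n : ℝ)) * ∑ i, ℓ p.2 (p.1 i)) ^ 2)) :=
    ((hΔ.pow_const 2).const_mul _).exp.ennreal_ofReal
  set F : (Fin n → Z) → ENNReal := fun S => ∫⁻ θ, ENNReal.ofReal (Real.exp ((2 * n - 1) *
      (∫ z, ℓ θ z ∂D - (1 / (n : ℝ)) * ∑ i, ℓ θ (S i)) ^ 2)) ∂(gaussianMeasure (0 : Fin d → ℝ) 1)
    with hF
  have hFm : Measurable F := hE.lintegral_prod_right'
  set K : ℝ := n * Real.exp 2 / δ with hKdef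
  have hK : 0 < K := by positivity
  have hEF : ∫⁻ S, F S ∂(Measure.pi fun _ : Fin n => D) ≤ ENNReal.ofReal (δ * K) := by
    rw [hF, lintegral_lintegral_swap hE.aemeasurable]
    calc _ ≤ ∫⁻ _ : Fin d → ℝ, ENNReal.ofReal (√(2 * n)) ∂(gaussianMeasure (0 : Fin d → ℝ) 1) :=
          lintegral_mono fun θ => aux_exp hn D (ℓ θ) (hmeas.comp measurable_prodMk_left) (hℓ θ)
      _ = ENNReal.ofReal (√(2 * n)) := by simp
      _ ≤ _ := by
          apply ENNReal.ofReal_le_ofReal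
          have h1 : δ * K = n * Real.exp 2 := by rw [hKdef]; field_simp
          have h2 : √(2 * n) ≤ 2 * n := Real.sqrt_le_iff.2 ⟨by positivity, by nlinarith⟩
          have h3 := Real.add_one_le_exp 2
          rw [h1]
          nlinarith
  have hbad : (Measure.pi fun _ : Fin n => D) {S | ENNReal.ofReal K ≤ F S} ≤ ENNReal.ofReal δ := by
    have h1 := (mul_meas_ge_le_lintegral hFm (ENNReal.ofReal K)).trans hEF
    rw [mul_comm δ, ENNReal.ofReal_mul hK.le] at h1
    exact (ENNReal.mul_le_mul_iff_right (by simpa using hK) ENNReal.ofReal_ne_top).1 h1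
  have hgood : 1 - ENNReal.ofReal δ ≤ (Measure.pi fun _ : Fin n => D) {S | F S < ENNReal.ofReal K} := by
    have h1 : {S | F S < ENNReal.ofReal K} = {S | ENNReal.ofReal K ≤ F S}ᶜ := by
      ext S; simp
    rw [h1, prob_compl_eq_one_sub (measurableSet_le measurable_const hFm)]
    exact tsub_le_tsub_left hbad 1
  refine hgood.trans (measure_mono ?_)
  intro S hS θ₁ Δθ J hJ
  have hS' : ((n : ℝ) • J)⁻¹.PosDef := (hJ.smul hn0).inv
  have hQ := aux_prob (θ₁ - Δθ) hS'
  set Q := gaussianMeasure (θ₁ - Δθ) ((n : ℝ) • J)⁻¹ with hQdef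
  have hΔS : Measurable fun θ => ∫ z, ℓ θ z ∂D - (1 / (n : ℝ)) * ∑ i, ℓ θ (S i) :=
    hΔ.comp measurable_prodMk_left
  have hb1 : ∀ θ, ∫ z, ℓ θ z ∂D ∈ Set.Icc (0 : ℝ) 1 := by
    intro θ
    refine ⟨integral_nonneg fun z => (hℓ θ z).1, ?_⟩
    have := integral_mono_of_nonneg (μ := D) (f := ℓ θ) (g := fun _ => 1)
      (ae_of_all _ fun z => (hℓ θ z).1) (integrable_const _) (ae_of_all _ fun z => (hℓ θ z).2)
    simpa using this
  have hb2 : ∀ θ, (1 / (n : ℝ)) * ∑ i, ℓ θ (S i) ∈ Set.Icc (0 : ℝ) 1 := by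
    intro θ
    refine ⟨mul_nonneg (by positivity) (Finset.sum_nonneg fun i _ => (hℓ _ _).1), ?_⟩
    have : ∑ i, ℓ θ (S i) ≤ n := by
      refine (Finset.sum_le_sum fun i _ => (hℓ θ (S i)).2).trans ?_
      simp
    rw [one_div, inv_mul_le_iff₀ hn0]; linarith
  have hi1 : Integrable (fun θ => ∫ z, ℓ θ z ∂D) Q :=
    Integrable.of_mem_Icc 0 1 hr.aemeasurable (ae_of_all _ hb1)
  have hi2 : Integrable (fun θ => (1 / (n : ℝ)) * ∑ i, ℓ θ (S i)) Q :=
    Integrable.of_mem_Icc 0 1 (((Finset.measurable_sum _ fun i _ =>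
      (hl i).comp measurable_prodMk_left).const_mul _).aemeasurable) (ae_of_all _ hb2)
  have hi3 : Integrable (fun θ => (∫ z, ℓ θ z ∂D - (1 / (n : ℝ)) * ∑ i, ℓ θ (S i)) ^ 2) Q := by
    refine Integrable.of_mem_Icc 0 1 (hΔS.pow_const 2).aemeasurable (ae_of_all _ fun θ => ?_)
    obtain ⟨a1, a2⟩ := hb1 θ
    obtain ⟨b1, b2⟩ := hb2 θ
    exact ⟨sq_nonneg _, by nlinarith⟩
  have hmain := aux_change (θ₁ - Δθ) hS' _ ((hΔS.pow_const 2).const_mul (2 * (n : ℝ) - 1))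
    (hi3.const_mul _) K hK hS.le
  rw [← hQdef, integral_const_mul] at hmain
  have hJen : (∫ θ, (∫ z, ℓ θ z ∂D - (1 / (n : ℝ)) * ∑ i, ℓ θ (S i)) ∂Q) ^ 2
      ≤ ∫ θ, (∫ z, ℓ θ z ∂D - (1 / (n : ℝ)) * ∑ i, ℓ θ (S i)) ^ 2 ∂Q :=
    (even_two.convexOn_pow (𝕜 := ℝ)).map_integral_le (by fun_prop) isClosed_univ (by simp)
      (hi1.sub hi2) hi3
  have hsplit : ∫ θ, (∫ z, ℓ θ z ∂D - (1 / (n : ℝ)) * ∑ i, ℓ θ (S i)) ∂Q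
      = expRisk D ℓ Q - empRisk ℓ Q S := integral_sub hi1 hi2
  rw [hsplit] at hJen
  have hinv : ((n : ℝ) • J)⁻¹ = (n : ℝ)⁻¹ • J⁻¹ := by
    have := hJ.det_pos.ne'.isUnit
    refine Matrix.inv_eq_right_inv ?_
    rw [Matrix.smul_mul, Matrix.mul_smul, Matrix.mul_nonsing_inv _ this, smul_smul,
      mul_inv_cancel₀ hn0.ne', one_smul]
  have htr : (((n : ℝ) • J)⁻¹).trace = (1 / (n : ℝ)) * (J⁻¹).trace := by
    rw [hinv, Matrix.trace_smul, smul_eq_mul, one_div]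
  have hdet : Real.log (((n : ℝ) • J)⁻¹).det = -(d * Real.log n + Real.log J.det) := by
    rw [Matrix.det_nonsing_inv, Ring.inverse_eq_inv', Real.log_inv, Matrix.det_smul,
      Real.log_mul (by positivity) hJ.det_pos.ne', Real.log_pow, Fintype.card_fin]
  have hlogK : Real.log K = Real.log n + 2 + Real.log (1 / δ) := by
    rw [hKdef, Real.log_div (by positivity) hδ0.ne', Real.log_mul hn0.ne' (Real.exp_pos _).ne',
      Real.log_exp, one_div, Real.log_inv]
    ring
  have hnorm : ∑ k, (θ₁ - Δθ) k ^ 2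
      ≤ euclNorm Δθ ^ 2 + 2 * euclNorm θ₁ * euclNorm Δθ + euclNorm θ₁ ^ 2 := by
    have e1 : euclNorm Δθ ^ 2 = ∑ k, Δθ k ^ 2 :=
      Real.sq_sqrt (Finset.sum_nonneg fun k _ => sq_nonneg _)
    have e2 : euclNorm θ₁ ^ 2 = ∑ k, θ₁ k ^ 2 :=
      Real.sq_sqrt (Finset.sum_nonneg fun k _ => sq_nonneg _)
    have cs : ∑ k, (-θ₁ k) * Δθ k ≤ euclNorm θ₁ * euclNorm Δθ := by
      have := Real.sum_mul_le_sqrt_mul_sqrt Finset.univ (fun k => -θ₁ k) Δθ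
      simpa only [neg_sq, euclNorm] using this
    have e3 : ∑ k, (θ₁ - Δθ) k ^ 2 = ∑ k, θ₁ k ^ 2 + ∑ k, Δθ k ^ 2 + 2 * ∑ k, (-θ₁ k) * Δθ k := by
      rw [Finset.mul_sum, ← Finset.sum_add_distrib, ← Finset.sum_add_distrib]
      exact Finset.sum_congr rfl fun k _ => by simp only [Pi.sub_apply]; ring
    rw [e3, e1, e2]
    linarith
  rw [htr, hdet, hlogK] at hmain
  rw [← sub_le_iff_le_add']
  apply Real.le_sqrt_of_sq_le
  rw [le_div_iff₀ (by linarith)]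
  have h2n : 0 < 2 * (n : ℝ) - 1 := by linarith
  have := mul_le_mul_of_nonneg_left hJen h2n.le
  linarith
end
end
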